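/- Let G = (μ, X, Y, A, B, V) be a two-player one-round game whose question distribution is a product distribution, μ = μ_X ⊗ μ_Y. Fix an entangled strategy for the k-fold product game G^k, and let (X₁,…,X_k, Y₁,…,Y_k, A₁,…,A_k, B₁,…,B_k) be random variables distributed according to P(x,y,a,b) = μ^{⊗k}(x,y)·⟨ψ| A^x_a ⊗ B^y_b |ψ⟩, with T_i := V(X_i, Y_i, A_i, B_i) ∈ {0,1} for each i ∈ [k]. Let 0 < δ₁, δ₂, δ₃ < 0.1 satisfy δ₃ = δ₂ + δ₁·log₂(|A|·|B|), and set k' := ⌊δ₁·k⌋. Then there exist distinct coordinates i₁, …, i_{k'} ∈ [k] such that for each 1 ≤ r ≤ k'−1, writing T^{(r)} := ∏_{j=1}^r T_{i_j}, either Pr[T^{(r)} = 1] ≤ 2^{−δ₂·k}, or Pr[T_{i_{r+1}} = 1 | T^{(r)} = 1] ≤ ω*(G) + 12·√(10·δ₃). -/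

import Mathlib

open Matrix Kronecker
open scoped ComplexOrder

noncomputable section

/-- A two-player one-round game: a question distribution `μ` on `X × Y` and a
predicate `V` on questions and answers. (The requirement that `μ` is a genuine
probability distribution is stated as a hypothesis in the theorems.) -/
structure Game (X Y A B : Type) where
  μ : X × Y → ℝ
  V : X → Y → A → B → Bool

/-- The winning probability of an entangled strategy, given by a shared unit vector
`ψ` on `ℂ^{dA} ⊗ ℂ^{dB}` and POVMs `{Al x a}_a` for Alice and `{Bo y b}_b` for Bob. -/
noncomputable def winProb {X Y A B : Type}
    [Fintype X] [Fintype Y] [Fintype A] [Fintype B] (G : Game X Y A B)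
    {dA dB : ℕ} (ψ : Fin dA × Fin dB → ℂ)
    (Al : X → A → Matrix (Fin dA) (Fin dA) ℂ)
    (Bo : Y → B → Matrix (Fin dB) (Fin dB) ℂ) : ℝ :=
  ∑ x : X, ∑ y : Y, ∑ a : A, ∑ b : B,
    G.μ (x, y) * (if G.V x y a b then 1 else 0) *
      (star ψ ⬝ᵥ ((Al x a ⊗ₖ Bo y b) *ᵥ ψ)).re

/-- The entangled value `ω*(G)`: the supremum of winning probabilities over all
entangled strategies (finite-dimensional shared entanglement and POVMs). -/
noncomputable def entangledValue {X Y A B : Type}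
    [Fintype X] [Fintype Y] [Fintype A] [Fintype B] (G : Game X Y A B) : ℝ :=
  sSup { p : ℝ | ∃ (dA dB : ℕ) (ψ : Fin dA × Fin dB → ℂ)
    (Al : X → A → Matrix (Fin dA) (Fin dA) ℂ)
    (Bo : Y → B → Matrix (Fin dB) (Fin dB) ℂ),
    star ψ ⬝ᵥ ψ = 1 ∧
    (∀ x a, (Al x a).PosSemidef) ∧ (∀ x, ∑ a : A, Al x a = 1) ∧
    (∀ y b, (Bo y b).PosSemidef) ∧ (∀ y, ∑ b : B, Bo y b = 1) ∧
    p = winProb G ψ Al Bo }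

/-- The `k`-fold product game `G^k`. -/
def gamePow {X Y A B : Type} (G : Game X Y A B) (k : ℕ) :
    Game (Fin k → X) (Fin k → Y) (Fin k → A) (Fin k → B) where
  μ := fun p => ∏ i, G.μ (p.1 i, p.2 i)
  V := fun x y a b => decide (∀ i, G.V (x i) (y i) (a i) (b i) = true)

-- sanity

/-- The probability, under the joint question/answer distribution
`P(x,y,a,b) = μ^{⊗k}(x,y)·⟨ψ| A^x_a ⊗ B^y_b |ψ⟩` induced by an entangled strategy for
`G^k`, of winning all coordinates `idx j` for `j < r` (i.e. `Pr[T^{(r)} = 1]` for the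
chosen coordinates `idx 0, …, idx (r-1)`). -/
noncomputable def succProb {X Y A B : Type}
    [Fintype X] [Fintype Y] [Fintype A] [Fintype B] (G : Game X Y A B)
    {k : ℕ} (P : (Fin k → X) → (Fin k → Y) → (Fin k → A) → (Fin k → B) → ℝ)
    {k' : ℕ} (idx : Fin k' → Fin k) (r : ℕ) : ℝ :=
  ∑ x : Fin k → X, ∑ y : Fin k → Y, ∑ a : Fin k → A, ∑ b : Fin k → B,
    if ∀ j : Fin k', (j : ℕ) < r →
        G.V (x (idx j)) (y (idx j)) (a (idx j)) (b (idx j)) = true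
    then P x y a b else 0

set_option linter.unusedSectionVars false
set_option linter.unusedSimpArgs false

section MatTools
variable {d : Type*} [Fintype d] [DecidableEq d]

/-- Continuity on the spectrum is automatic for matrices. -/
lemma contOn_spec (f : ℝ → ℝ) (S : Matrix d d ℂ) : ContinuousOn f (spectrum ℝ S) :=
  (Matrix.finite_real_spectrum (A := S)).continuousOn f

lemma trace_mul_nonneg_re {P Q : Matrix d d ℂ} (hP : P.PosSemidef) (hQ : Q.PosSemidef) :
    0 ≤ (trace (P * Q)).re := by
  obtain ⟨R, rfl⟩ : ∃ R : Matrix d d ℂ, Q = Rᴴ * R := by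
    open scoped MatrixOrder in
    obtain ⟨R, hR⟩ := CStarAlgebra.nonneg_iff_eq_star_mul_self.mp (Matrix.nonneg_iff_posSemidef.mpr hQ)
    exact ⟨R, hR⟩
  rw [← Matrix.mul_assoc, Matrix.trace_mul_comm, ← Matrix.mul_assoc]
  have := (hP.mul_mul_conjTranspose_same R).trace_nonneg
  exact (Complex.le_def.mp this).1

/-- Nussbaum-Szkola type double-basis formula for traces. -/
lemma ns_formula {S T : Matrix d d ℂ} (hS : S.PosSemidef) (hT : T.PosSemidef) :
    ∃ (c : d → d → ℝ) (l m : d → ℝ), (∀ i j, 0 ≤ c i j) ∧ (∀ i, 0 ≤ l i) ∧ (∀ i, 0 ≤ m i) ∧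
      ∀ f g : ℝ → ℝ, (trace (cfc f S * cfc g T)).re = ∑ i, ∑ j, c i j * (f (l i) * g (m j)) := by
  set U : Matrix d d ℂ := (hS.isHermitian.eigenvectorUnitary : Matrix d d ℂ) with hU
  set W : Matrix d d ℂ := (hT.isHermitian.eigenvectorUnitary : Matrix d d ℂ) with hW
  refine ⟨fun i j => Complex.normSq ((star U * W) i j), hS.isHermitian.eigenvalues,
    hT.isHermitian.eigenvalues, fun i j => Complex.normSq_nonneg _, hS.eigenvalues_nonneg,
    hT.eigenvalues_nonneg, fun f g => ?_⟩
  rw [hS.isHermitian.cfc_eq, hT.isHermitian.cfc_eq, IsHermitian.cfc, IsHermitian.cfc,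
    Unitary.conjStarAlgAut_apply, Unitary.conjStarAlgAut_apply]
  simp only [Unitary.coe_star, ← hU, ← hW]
  set D := diagonal ((RCLike.ofReal : ℝ → ℂ) ∘ f ∘ hS.isHermitian.eigenvalues) with hD
  set E := diagonal ((RCLike.ofReal : ℝ → ℂ) ∘ g ∘ hT.isHermitian.eigenvalues) with hE
  have h1 : trace (U * D * star U * (W * E * star W)) =
      trace (D * (star U * W) * E * star (star U * W)) := by
    rw [Matrix.mul_assoc, Matrix.mul_assoc, Matrix.trace_mul_comm]
    simp only [star_mul, star_star, Matrix.mul_assoc]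
  rw [h1, Matrix.trace, Complex.re_sum]
  refine Finset.sum_congr rfl fun i _ => ?_
  rw [Matrix.diag_apply, Matrix.mul_apply, Complex.re_sum]
  refine Finset.sum_congr rfl fun j _ => ?_
  rw [hD, hE, Matrix.mul_diagonal, Matrix.diagonal_mul, Matrix.star_apply]
  simp only [Function.comp]
  generalize (star U * W) i j = z
  simp [Complex.normSq_apply]
  ring

lemma cfc_shift {S : Matrix d d ℂ} (hS : S.PosSemidef) (e : ℝ) (f : ℝ → ℝ) :
    cfc f (S + algebraMap ℝ _ e) = cfc (fun t => f (t + e)) S := by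
  have h : S + algebraMap ℝ _ e = cfc (fun t : ℝ => t + e) S := by
    rw [cfc_add_const e (fun t => t) S (contOn_spec _ _) hS.isHermitian.isSelfAdjoint,
      cfc_id' ℝ S hS.isHermitian.isSelfAdjoint]
  rw [h, ← cfc_comp' f (fun t : ℝ => t + e) S (((Matrix.finite_real_spectrum (A := S)).image _).continuousOn _) (contOn_spec _ _) hS.isHermitian.isSelfAdjoint]

lemma cfc_add_id {S : Matrix d d ℂ} (hS : S.PosSemidef) (e : ℝ) :
    cfc (fun t : ℝ => t + e) S = S + algebraMap ℝ _ e := by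
  rw [cfc_add_const e (fun t => t) S (contOn_spec _ _) hS.isHermitian.isSelfAdjoint,
      cfc_id' ℝ S hS.isHermitian.isSelfAdjoint]

open scoped MatrixOrder Matrix.Norms.L2Operator in
lemma log_mono {S T : Matrix d d ℂ} (hS : S.PosSemidef) (hT : T.PosSemidef)
    (h : (T - S).PosSemidef) {e : ℝ} (he : 0 < e) :
    (cfc (fun t => Real.log (t + e)) T - cfc (fun t => Real.log (t + e)) S).PosSemidef := by
  rw [← cfc_shift hS e Real.log, ← cfc_shift hT e Real.log]
  have h1 : S + algebraMap ℝ _ e ≤ T + algebraMap ℝ _ e := by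
    rw [Matrix.le_iff]; simpa using h
  have h2 : IsStrictlyPositive (S + algebraMap ℝ (Matrix d d ℂ) e) := by
    rw [Matrix.isStrictlyPositive_iff_posDef]
    refine Matrix.PosDef.posSemidef_add hS ?_
    rw [Algebra.algebraMap_eq_smul_one]
    exact Matrix.PosDef.one.smul he
  exact CFC.log_le_log h1 h2

end MatTools

section Ent
variable {d : Type*} [Fintype d] [DecidableEq d]

/-- Regularised (negative) entropy potential. -/
def phiE (e : ℝ) (S : Matrix d d ℂ) : ℝ :=
  (trace (cfc (fun t : ℝ => (t + e) * Real.log (t + e)) S)).re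

/-- Regularised cross term `Tr (S + e) log (T + e)`. -/
def crossE (e : ℝ) (S T : Matrix d d ℂ) : ℝ :=
  (trace (cfc (fun t : ℝ => t + e) S * cfc (fun t : ℝ => Real.log (t + e)) T)).re

/-- Regularised affinity. -/
def affE (e : ℝ) (S T : Matrix d d ℂ) : ℝ :=
  (trace (cfc (fun t : ℝ => Real.sqrt (t + e)) S * cfc (fun t : ℝ => Real.sqrt (t + e)) T)).re

lemma cfc_one_psd {T : Matrix d d ℂ} (hT : T.PosSemidef) : cfc (fun _ : ℝ => (1 : ℝ)) T = 1 :=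
  cfc_const_one ℝ T (ha := hT.isHermitian.isSelfAdjoint)

lemma trace_shift_re {S : Matrix d d ℂ} (hS : S.PosSemidef) (e : ℝ) :
    (trace (cfc (fun t : ℝ => t + e) S)).re = (trace S).re + e * Fintype.card d := by
  rw [cfc_add_id hS, trace_add, Algebra.algebraMap_eq_smul_one, trace_smul, trace_one]
  simp

lemma ent_step {S T : Matrix d d ℂ} (hS : S.PosSemidef) (hT : T.PosSemidef) {e : ℝ} (he : 0 < e) :
    2 * ((trace S).re + e * Fintype.card d) - 2 * affE e S T ≤ phiE e S - crossE e S T := by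
  obtain ⟨c, l, m, hc, hl, hm, H⟩ := ns_formula hS hT
  have h1 : (trace S).re + e * Fintype.card d = ∑ i, ∑ j, c i j * ((l i + e) * 1) := by
    rw [← trace_shift_re hS, ← H (fun t => t + e) (fun _ => 1), cfc_one_psd hT, mul_one]
  have h2 : phiE e S = ∑ i, ∑ j, c i j * (((l i + e) * Real.log (l i + e)) * 1) := by
    rw [phiE, ← H (fun t => (t + e) * Real.log (t + e)) (fun _ => 1), cfc_one_psd hT, mul_one]
  rw [h1, h2, crossE, affE, H, H]
  simp only [Finset.mul_sum, ← Finset.sum_sub_distrib]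
  refine Finset.sum_le_sum fun i _ => Finset.sum_le_sum fun j _ => ?_
  have hli : 0 < l i + e := add_pos_of_nonneg_of_pos (hl i) he
  have hmj : 0 < m j + e := add_pos_of_nonneg_of_pos (hm j) he
  set a := Real.sqrt (l i + e) with ha
  set b := Real.sqrt (m j + e) with hb
  have ha0 : 0 < a := Real.sqrt_pos.mpr hli
  have hb0 : 0 < b := Real.sqrt_pos.mpr hmj
  have ha2 : l i + e = a ^ 2 := (Real.sq_sqrt hli.le).symm
  have hb2 : m j + e = b ^ 2 := (Real.sq_sqrt hmj.le).symm
  rw [ha2, hb2, Real.log_pow, Real.log_pow]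
  have hlog : Real.log (b / a) ≤ b / a - 1 := Real.log_le_sub_one_of_pos (by positivity)
  rw [Real.log_div hb0.ne' ha0.ne'] at hlog
  have : a ^ 2 * (Real.log b - Real.log a) ≤ a * b - a ^ 2 := by
    calc a ^ 2 * (Real.log b - Real.log a) ≤ a ^ 2 * (b / a - 1) := by gcongr
      _ = a * b - a ^ 2 := by field_simp
  have h3 := mul_le_mul_of_nonneg_left this (hc i j)
  push_cast
  nlinarith [h3]

lemma ent_fin {S T : Matrix d d ℂ} (hS : S.PosSemidef) (hT : T.PosSemidef)
    (h : (T - S).PosSemidef) {e : ℝ} (he : 0 < e) : phiE e S ≤ crossE e S T := by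
  have h1 : cfc (fun t : ℝ => (t + e) * Real.log (t + e)) S =
      cfc (fun t : ℝ => t + e) S * cfc (fun t : ℝ => Real.log (t + e)) S :=
    cfc_mul (fun t : ℝ => t + e) (fun t : ℝ => Real.log (t + e)) S (contOn_spec _ _)
      (contOn_spec _ _)
  have h2 : (cfc (fun t : ℝ => t + e) S).PosSemidef := by
    rw [cfc_add_id hS, Algebra.algebraMap_eq_smul_one]
    exact hS.add (Matrix.PosSemidef.one.smul he.le)
  have := trace_mul_nonneg_re h2 (log_mono hS hT h he)
  rw [Matrix.mul_sub, trace_sub, Complex.sub_re] at this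
  rw [phiE, crossE, h1]
  linarith

lemma ent_klein {S T : Matrix d d ℂ} (hS : S.PosSemidef) (hT : T.PosSemidef)
    (hT1 : (trace T).re ≤ 1) {e : ℝ} (he : 0 < e) :
    crossE e S T - phiE e S ≤ Real.negMulLog ((trace S).re + e * Fintype.card d) +
      ((trace S).re + e * Fintype.card d) * Real.log (1 + e * Fintype.card d) := by
  rcases isEmpty_or_nonempty d with hd | hd
  · simp [crossE, phiE, Matrix.trace]
  obtain ⟨c, l, m, hc, hl, hm, H⟩ := ns_formula hS hT
  have hS0 : 0 ≤ (trace S).re := (Complex.le_def.mp hS.trace_nonneg).1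
  set Q := (trace S).re + e * Fintype.card d with hQ
  set P := 1 + e * (Fintype.card d : ℝ) with hP
  have hcard : 0 < (Fintype.card d : ℝ) := by exact_mod_cast Fintype.card_pos
  have hQ0 : 0 < Q := by positivity
  have hP0 : 0 < P := by positivity
  have h1 : Q = ∑ i, ∑ j, c i j * ((l i + e) * 1) := by
    rw [hQ, ← trace_shift_re hS, ← H (fun t => t + e) (fun _ => 1), cfc_one_psd hT, mul_one]
  have h1' : ∑ i, ∑ j, c i j * (1 * (m j + e)) ≤ P := by
    rw [← H (fun _ => 1) (fun t => t + e), cfc_one_psd hS, one_mul, trace_shift_re hT]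
    linarith
  have h2 : phiE e S = ∑ i, ∑ j, c i j * (((l i + e) * Real.log (l i + e)) * 1) := by
    rw [phiE, ← H (fun t => (t + e) * Real.log (t + e)) (fun _ => 1), cfc_one_psd hT, mul_one]
  have key : crossE e S T - phiE e S + Q * (Real.log Q - Real.log P) ≤
      (Q / P) * ∑ i, ∑ j, c i j * (1 * (m j + e)) - Q := by
    have e1 : Q * (Real.log Q - Real.log P) =
        ∑ i, ∑ j, c i j * ((l i + e) * 1) * (Real.log Q - Real.log P) := by
      generalize Real.log Q - Real.log P = z
      rw [h1]
      simp only [Finset.sum_mul]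
    have e2 : (Q / P) * ∑ i, ∑ j, c i j * (1 * (m j + e)) - Q =
        (Q / P) * ∑ i, ∑ j, c i j * (1 * (m j + e)) - ∑ i, ∑ j, c i j * ((l i + e) * 1) := by
      rw [← h1]
    rw [e1, e2, h2, crossE, H]
    simp only [Finset.mul_sum, ← Finset.sum_sub_distrib, ← Finset.sum_add_distrib]
    refine Finset.sum_le_sum fun i _ => Finset.sum_le_sum fun j _ => ?_
    have hli : 0 < l i + e := add_pos_of_nonneg_of_pos (hl i) he
    have hmj : 0 < m j + e := add_pos_of_nonneg_of_pos (hm j) he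
    set a := l i + e
    set b := m j + e
    have hlog : Real.log ((b / a) * (Q / P)) ≤ (b / a) * (Q / P) - 1 :=
      Real.log_le_sub_one_of_pos (by positivity)
    rw [Real.log_mul (by positivity) (by positivity), Real.log_div hmj.ne' hli.ne',
      Real.log_div hQ0.ne' hP0.ne'] at hlog
    have h3 : a * (Real.log b - Real.log a + (Real.log Q - Real.log P)) ≤ b * (Q / P) - a := by
      calc _ ≤ a * (b / a * (Q / P) - 1) := by gcongr
        _ = _ := by field_simp
    have h4 := mul_le_mul_of_nonneg_left h3 (hc i j)
    nlinarith [h4]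
  have h5 : (Q / P) * ∑ i, ∑ j, c i j * (1 * (m j + e)) ≤ Q := by
    calc _ ≤ (Q / P) * P := by gcongr
      _ = Q := by field_simp
  rw [Real.negMulLog]
  linarith

lemma affE_tendsto {S T : Matrix d d ℂ} (hS : S.PosSemidef) (hT : T.PosSemidef) :
    Filter.Tendsto (fun e => affE e S T) (nhdsWithin 0 (Set.Ioi 0)) (nhds (affE 0 S T)) := by
  obtain ⟨c, l, m, hc, hl, hm, H⟩ := ns_formula hS hT
  have : (fun e => affE e S T) = fun e => ∑ i, ∑ j, c i j * (Real.sqrt (l i + e) * Real.sqrt (m j + e)) := by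
    funext e
    rw [affE, H]
  have hcont : Continuous (fun e => affE e S T) := by
    rw [this]
    fun_prop
  exact hcont.continuousWithinAt.tendsto

end Ent

section Prod
variable {X : Type*} [Fintype X] {k : ℕ}

/-- Product weight. -/
def wt (μ : X → ℝ) (x : Fin k → X) : ℝ := ∏ i, μ (x i)

/-- Overwrite: take `u` on the coordinates satisfying `p`, and `x` elsewhere. -/
def ov (p : Fin k → Prop) [DecidablePred p] (u x : Fin k → X) : Fin k → X :=
  fun i => if p i then u i else x i

lemma wt_nonneg {μ : X → ℝ} (h0 : ∀ x, 0 ≤ μ x) (x : Fin k → X) : 0 ≤ wt μ x :=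
  Finset.prod_nonneg fun _ _ => h0 _

lemma wt_sum {μ : X → ℝ} (h1 : ∑ x, μ x = 1) : ∑ x : Fin k → X, wt μ x = 1 := by
  unfold wt
  rw [← Fintype.prod_sum (fun (_ : Fin k) x => μ x)]
  simp [h1]

lemma wt_ov (μ : X → ℝ) (p : Fin k → Prop) [DecidablePred p] (u x : Fin k → X) :
    wt μ (ov p u x) * wt μ (ov p x u) = wt μ u * wt μ x := by
  unfold wt ov
  rw [← Finset.prod_mul_distrib, ← Finset.prod_mul_distrib]
  refine Finset.prod_congr rfl fun i _ => ?_
  by_cases h : p i <;> simp [h, mul_comm]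

lemma ov_ov (p : Fin k → Prop) [DecidablePred p] (u x : Fin k → X) :
    ov p (ov p u x) (ov p x u) = u := by
  funext i
  by_cases h : p i <;> simp [ov, h]

/-- The swap involution. -/
def ovEquiv (p : Fin k → Prop) [DecidablePred p] :
    ((Fin k → X) × (Fin k → X)) ≃ ((Fin k → X) × (Fin k → X)) where
  toFun z := (ov p z.1 z.2, ov p z.2 z.1)
  invFun z := (ov p z.1 z.2, ov p z.2 z.1)
  left_inv z := by simp [ov_ov]
  right_inv z := by simp [ov_ov]

variable {E : Type*} [AddCommGroup E] [Module ℝ E]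

lemma resample2 (μ : X → ℝ) (p : Fin k → Prop) [DecidablePred p]
    (F : (Fin k → X) → (Fin k → X) → E) :
    ∑ u, ∑ x, (wt μ u * wt μ x) • F (ov p u x) (ov p x u) = ∑ u, ∑ x, (wt μ u * wt μ x) • F u x := by
  rw [← Fintype.sum_prod_type' (f := fun u x => (wt μ u * wt μ x) • F (ov p u x) (ov p x u)),
    ← Fintype.sum_prod_type' (f := fun u x => (wt μ u * wt μ x) • F u x)]
  refine Fintype.sum_equiv (ovEquiv p) _ _ fun z => ?_
  simp [ovEquiv, wt_ov]

lemma resample {μ : X → ℝ} (h1 : ∑ x, μ x = 1) (p : Fin k → Prop) [DecidablePred p]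
    (f : (Fin k → X) → E) :
    ∑ u, ∑ x, (wt μ u * wt μ x) • f (ov p u x) = ∑ u, wt μ u • f u := by
  rw [resample2 μ p (fun u _ => f u)]
  refine Finset.sum_congr rfl fun u _ => ?_
  rw [← Finset.sum_smul, ← Finset.mul_sum, wt_sum h1, mul_one]

lemma wt_update (μ : X → ℝ) (i : Fin k) (x : Fin k → X) (s : X) :
    μ (x i) * wt μ (Function.update x i s) = μ s * wt μ x := by
  unfold wt
  rw [← Finset.mul_prod_erase _ _ (Finset.mem_univ i), ← Finset.mul_prod_erase _ (fun j => μ (x j)) (Finset.mem_univ i)]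
  have : ∏ j ∈ Finset.univ.erase i, μ (Function.update x i s j) = ∏ j ∈ Finset.univ.erase i, μ (x j) := by
    refine Finset.prod_congr rfl fun j hj => ?_
    rw [Function.update_of_ne (Finset.ne_of_mem_erase hj)]
  rw [this, Function.update_self]
  ring

/-- The update involution. -/
def updEquiv (i : Fin k) : (X × (Fin k → X)) ≃ (X × (Fin k → X)) where
  toFun z := (z.2 i, Function.update z.2 i z.1)
  invFun z := (z.2 i, Function.update z.2 i z.1)
  left_inv z := by simp
  right_inv z := by simp

lemma resample_upd (μ : X → ℝ) (i : Fin k) (F : X → (Fin k → X) → E) :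
    ∑ s, ∑ x, (μ s * wt μ x) • F (x i) (Function.update x i s) = ∑ s, ∑ x, (μ s * wt μ x) • F s x := by
  rw [← Fintype.sum_prod_type' (f := fun s x => (μ s * wt μ x) • F (x i) (Function.update x i s)),
    ← Fintype.sum_prod_type' (f := fun s x => (μ s * wt μ x) • F s x)]
  refine Fintype.sum_equiv (updEquiv i) _ _ fun z => ?_
  simp [updEquiv, wt_update]

lemma resample_upd1 {μ : X → ℝ} (h1 : ∑ x, μ x = 1) (i : Fin k) (f : (Fin k → X) → E) :
    ∑ s, ∑ x, (μ s * wt μ x) • f (Function.update x i s) = ∑ x, wt μ x • f x := by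
  rw [resample_upd μ i (fun _ x => f x), Finset.sum_comm]
  refine Finset.sum_congr rfl fun u _ => ?_
  rw [← Finset.sum_smul, ← Finset.sum_mul, h1, one_mul]

/-- Resampling, in the form where the new value is also visible. -/
lemma resample_upd2 {μ : X → ℝ} (h1 : ∑ x, μ x = 1) (i : Fin k) (F : X → (Fin k → X) → E) :
    ∑ s, ∑ x, (μ s * wt μ x) • F s (Function.update x i s) = ∑ x, wt μ x • F (x i) x := by
  have := resample_upd μ i (fun s x => F s (Function.update x i s))
  rw [← this, Finset.sum_comm]
  refine Finset.sum_congr rfl fun u _ => ?_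
  simp only [Function.update_idem, Function.update_eq_self]
  rw [← Finset.sum_smul, ← Finset.sum_mul, h1, one_mul]

/-- Conditional expectation given the first `j` coordinates. -/
def cavg (μ : X → ℝ) (j : ℕ) (S : (Fin k → X) → E) (x : Fin k → X) : E :=
  ∑ x', wt μ x' • S (ov (fun i => i.val < j) x x')

lemma cavg_zero (μ : X → ℝ) (S : (Fin k → X) → E) (x : Fin k → X) :
    cavg μ 0 S x = ∑ x', wt μ x' • S x' := by
  have h : ∀ x', ov (fun i : Fin k => i.val < 0) x x' = x' := fun x' => by
    funext i; simp [ov]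
  simp only [cavg, h]

lemma cavg_last {μ : X → ℝ} (h1 : ∑ x, μ x = 1) (S : (Fin k → X) → E) (x : Fin k → X) :
    cavg μ k S x = S x := by
  have h : ∀ x', ov (fun i : Fin k => i.val < k) x x' = x := fun x' => by
    funext i; simp [ov]
  simp only [cavg, h]
  rw [← Finset.sum_smul, wt_sum h1, one_smul]

lemma ov_upd_left (i : Fin k) (x x' : Fin k → X) (s : X) :
    ov (fun j => j.val < i.val + 1) (Function.update x i s) x' =
      Function.update (ov (fun j => j.val < i.val) x x') i s := by
  funext j
  by_cases h : j = i
  · subst h; simp [ov]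
  · have : j.val ≠ i.val := fun h' => h (Fin.ext h')
    have h2 : j.val < i.val + 1 ↔ j.val < i.val := by omega
    simp [ov, Function.update_of_ne h, h2]

lemma ov_upd_right (i : Fin k) (x x' : Fin k → X) (s : X) :
    ov (fun j => j.val < i.val) x (Function.update x' i s) =
      Function.update (ov (fun j => j.val < i.val) x x') i s := by
  funext j
  by_cases h : j = i
  · subst h; simp [ov]
  · simp [ov, Function.update_of_ne h]

lemma ov_upd_left' (i : Fin k) (x x' : Fin k → X) (s : X) :
    ov (fun j => j.val < i.val) (Function.update x i s) x' =
      ov (fun j => j.val < i.val) x x' := by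
  funext j
  by_cases h : j = i
  · subst h; simp [ov]
  · simp [ov, Function.update_of_ne h]

lemma cavg_step {μ : X → ℝ} (h1 : ∑ x, μ x = 1) (i : Fin k) (S : (Fin k → X) → E) (x : Fin k → X) :
    ∑ s, μ s • cavg μ (i.val + 1) S (Function.update x i s) = cavg μ i.val S x := by
  simp only [cavg, ov_upd_left, ← ov_upd_right, Finset.smul_sum, smul_smul]
  exact resample_upd1 h1 i (fun x' => S (ov (fun j => j.val < i.val) x x'))

lemma cavg_upd (μ : X → ℝ) (i : Fin k) (S : (Fin k → X) → E) (x : Fin k → X) (s : X) :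
    cavg μ i.val S (Function.update x i s) = cavg μ i.val S x := by
  simp only [cavg, ov_upd_left']

end Prod

section EntBound
variable {X : Type*} [Fintype X] {k : ℕ} {d : Type*} [Fintype d] [DecidableEq d]

lemma psd_sum_smul {ι : Type*} [Fintype ι] {w : ι → ℝ} (hw : ∀ i, 0 ≤ w i) {S : ι → Matrix d d ℂ}
    (hS : ∀ i, (S i).PosSemidef) : (∑ i, w i • S i).PosSemidef :=
  posSemidef_sum _ fun i _ => (hS i).smul (hw i)

lemma cross_lin {ι : Type*} [Fintype ι] {w : ι → ℝ} (hw : ∀ i, 0 ≤ w i) (hw1 : ∑ i, w i = 1)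
    {S : ι → Matrix d d ℂ} (hS : ∀ i, (S i).PosSemidef) (e : ℝ) (T : Matrix d d ℂ) :
    ∑ i, w i * crossE e (S i) T = crossE e (∑ i, w i • S i) T := by
  have h : cfc (fun t : ℝ => t + e) (∑ i, w i • S i) = ∑ i, w i • cfc (fun t : ℝ => t + e) (S i) := by
    rw [cfc_add_id (psd_sum_smul hw hS)]
    simp only [fun i => cfc_add_id (hS i) e, smul_add, Finset.sum_add_distrib, ← Finset.sum_smul, hw1,
      one_smul]
  rw [crossE, h, Finset.sum_mul, trace_sum, Complex.re_sum]
  refine Finset.sum_congr rfl fun i _ => ?_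
  rw [smul_mul_assoc, trace_smul, Complex.smul_re, crossE, smul_eq_mul]

lemma crossE_self {S : Matrix d d ℂ} (e : ℝ) : crossE e S S = phiE e S := by
  rw [phiE, crossE, ← cfc_mul (fun t : ℝ => t + e) (fun t : ℝ => Real.log (t + e)) S
    (contOn_spec _ _) (contOn_spec _ _)]

lemma cavg_psd {μ : X → ℝ} (h0 : ∀ x, 0 ≤ μ x) {S : (Fin k → X) → Matrix d d ℂ}
    (hS : ∀ x, (S x).PosSemidef) (j : ℕ) (x : Fin k → X) : (cavg μ j S x).PosSemidef :=
  psd_sum_smul (wt_nonneg h0) fun _ => hS _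

lemma ent_level {μ : X → ℝ} (h0 : ∀ x, 0 ≤ μ x) (h1 : ∑ x, μ x = 1)
    {S : (Fin k → X) → Matrix d d ℂ} (hS : ∀ x, (S x).PosSemidef) {e : ℝ} (he : 0 < e) (i : Fin k) :
    ∑ x, wt μ x * ∑ s, μ s *
      (2 * ((trace (cavg μ (i.val + 1) S (Function.update x i s))).re + e * Fintype.card d)
        - 2 * affE e (cavg μ (i.val + 1) S (Function.update x i s)) (cavg μ i.val S x)) ≤
    ∑ x, wt μ x * phiE e (cavg μ (i.val + 1) S x) - ∑ x, wt μ x * phiE e (cavg μ i.val S x) := by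
  have hA : ∑ x, wt μ x * phiE e (cavg μ (i.val + 1) S x) =
      ∑ x, wt μ x * ∑ s, μ s * phiE e (cavg μ (i.val + 1) S (Function.update x i s)) := by
    have := resample_upd1 h1 i (fun x => phiE e (cavg μ (i.val + 1) S x))
    simp only [smul_eq_mul] at this
    rw [← this, Finset.sum_comm]
    refine Finset.sum_congr rfl fun x _ => ?_
    rw [Finset.mul_sum]
    exact Finset.sum_congr rfl fun s _ => by ring
  rw [hA, ← Finset.sum_sub_distrib]
  refine Finset.sum_le_sum fun x _ => ?_
  rw [← mul_sub]
  refine mul_le_mul_of_nonneg_left ?_ (wt_nonneg h0 x)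
  have hB : phiE e (cavg μ i.val S x) =
      ∑ s, μ s * crossE e (cavg μ (i.val + 1) S (Function.update x i s)) (cavg μ i.val S x) := by
    rw [cross_lin h0 h1 (fun s => cavg_psd h0 hS _ _), cavg_step h1, crossE_self]
  rw [hB, ← Finset.sum_sub_distrib]
  refine Finset.sum_le_sum fun s _ => ?_
  rw [← mul_sub (μ s) (phiE _ _)]
  exact mul_le_mul_of_nonneg_left (ent_step (cavg_psd h0 hS _ _) (cavg_psd h0 hS _ _) he) (h0 s)

lemma ent_bound_eps {μ : X → ℝ} (h0 : ∀ x, 0 ≤ μ x) (h1 : ∑ x, μ x = 1)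
    {S : (Fin k → X) → Matrix d d ℂ} (hS : ∀ x, (S x).PosSemidef) {T : Matrix d d ℂ}
    (hT : T.PosSemidef) (hT1 : (trace T).re ≤ 1) (hST : ∀ x, (T - S x).PosSemidef)
    {e : ℝ} (he : 0 < e) :
    ∑ i : Fin k, ∑ x, wt μ x * ∑ s, μ s *
      (2 * ((trace (cavg μ (i.val + 1) S (Function.update x i s))).re + e * Fintype.card d)
        - 2 * affE e (cavg μ (i.val + 1) S (Function.update x i s)) (cavg μ i.val S x)) ≤
    Real.negMulLog ((trace (∑ x, wt μ x • S x)).re + e * Fintype.card d) +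
      ((trace (∑ x, wt μ x • S x)).re + e * Fintype.card d) * Real.log (1 + e * Fintype.card d) := by
  refine (Finset.sum_le_sum fun i _ => ent_level h0 h1 hS he i).trans ?_
  rw [Fin.sum_univ_eq_sum_range (fun i => ∑ x, wt μ x * phiE e (cavg μ (i + 1) S x) -
    ∑ x, wt μ x * phiE e (cavg μ i S x)) k,
    Finset.sum_range_sub (fun i => ∑ x, wt μ x * phiE e (cavg μ i S x))]
  simp only [cavg_last h1, cavg_zero, ← Finset.sum_mul, wt_sum h1, one_mul]
  have hle : ∑ x, wt μ x * phiE e (S x) ≤ crossE e (∑ x, wt μ x • S x) T := by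
    rw [← cross_lin (wt_nonneg h0) (wt_sum h1) hS]
    exact Finset.sum_le_sum fun x _ =>
      mul_le_mul_of_nonneg_left (ent_fin (hS x) hT (hST x) he) (wt_nonneg h0 x)
  have := ent_klein (psd_sum_smul (wt_nonneg h0) hS) hT hT1 he
  linarith

lemma ent_bound {μ : X → ℝ} (h0 : ∀ x, 0 ≤ μ x) (h1 : ∑ x, μ x = 1)
    {S : (Fin k → X) → Matrix d d ℂ} (hS : ∀ x, (S x).PosSemidef) {T : Matrix d d ℂ}
    (hT : T.PosSemidef) (hT1 : (trace T).re ≤ 1) (hST : ∀ x, (T - S x).PosSemidef) :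
    ∑ i : Fin k, ∑ x, wt μ x * ∑ s, μ s *
      (2 * (trace (cavg μ (i.val + 1) S (Function.update x i s))).re
        - 2 * affE 0 (cavg μ (i.val + 1) S (Function.update x i s)) (cavg μ i.val S x)) ≤
    Real.negMulLog ((trace (∑ x, wt μ x • S x)).re) := by
  have hid : Filter.Tendsto (fun e : ℝ => e) (nhdsWithin 0 (Set.Ioi 0)) (nhds 0) :=
    Filter.tendsto_id.mono_left nhdsWithin_le_nhds
  have hl : Filter.Tendsto (fun e : ℝ => ∑ i : Fin k, ∑ x, wt μ x * ∑ s, μ s *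
      (2 * ((trace (cavg μ (i.val + 1) S (Function.update x i s))).re + e * Fintype.card d)
        - 2 * affE e (cavg μ (i.val + 1) S (Function.update x i s)) (cavg μ i.val S x)))
      (nhdsWithin 0 (Set.Ioi 0)) (nhds (∑ i : Fin k, ∑ x, wt μ x * ∑ s, μ s *
      (2 * ((trace (cavg μ (i.val + 1) S (Function.update x i s))).re + 0 * Fintype.card d)
        - 2 * affE 0 (cavg μ (i.val + 1) S (Function.update x i s)) (cavg μ i.val S x)))) := by
    refine tendsto_finsetSum _ fun i _ => tendsto_finsetSum _ fun x _ =>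
      Filter.Tendsto.const_mul _ (tendsto_finsetSum _ fun s _ => Filter.Tendsto.const_mul _ ?_)
    exact ((((hid.mul_const _).const_add _).const_mul 2)).sub
      ((affE_tendsto (cavg_psd h0 hS _ _) (cavg_psd h0 hS _ _)).const_mul 2)
  have hr : Filter.Tendsto (fun e : ℝ =>
      Real.negMulLog ((trace (∑ x, wt μ x • S x)).re + e * Fintype.card d) +
      ((trace (∑ x, wt μ x • S x)).re + e * Fintype.card d) * Real.log (1 + e * Fintype.card d))
      (nhdsWithin 0 (Set.Ioi 0)) (nhds (Real.negMulLog ((trace (∑ x, wt μ x • S x)).re + 0 * Fintype.card d) +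
      ((trace (∑ x, wt μ x • S x)).re + 0 * Fintype.card d) * Real.log (1 + 0 * Fintype.card d))) := by
    have hq := (hid.mul_const (Fintype.card d : ℝ)).const_add (trace (∑ x, wt μ x • S x)).re
    refine ((Real.continuous_negMulLog.tendsto _).comp hq).add (hq.mul ?_)
    exact ((hid.mul_const (Fintype.card d : ℝ)).const_add 1).log (by simp)
  have hfin := le_of_tendsto_of_tendsto hl hr (by
    filter_upwards [self_mem_nhdsWithin] with e he
    exact ent_bound_eps h0 h1 hS hT hT1 hST he)
  simpa using hfin

end EntBound

section Frob
variable {m n r d : Type*} [Fintype m] [Fintype n] [Fintype r] [Fintype d]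

/-- Squared Frobenius norm. -/
def fsq (M : Matrix m n ℂ) : ℝ := ∑ i, ∑ j, Complex.normSq (M i j)

lemma fsq_nonneg (M : Matrix m n ℂ) : 0 ≤ fsq M :=
  Finset.sum_nonneg fun _ _ => Finset.sum_nonneg fun _ _ => Complex.normSq_nonneg _

lemma fsq_eq (M : Matrix m n ℂ) : fsq M = (trace (Mᴴ * M)).re := by
  rw [fsq, Matrix.trace, Complex.re_sum, Finset.sum_comm]
  refine Finset.sum_congr rfl fun j _ => ?_
  rw [Matrix.diag_apply, Matrix.mul_apply, Complex.re_sum]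
  refine Finset.sum_congr rfl fun i _ => ?_
  simp [Complex.normSq_apply]

lemma fsq_transpose (M : Matrix m n ℂ) : fsq Mᵀ = fsq M := by
  simp only [fsq, Matrix.transpose_apply]
  exact Finset.sum_comm

lemma normSq_add_le (a b : ℂ) : Complex.normSq (a + b) ≤ 2 * Complex.normSq a + 2 * Complex.normSq b := by
  simp only [Complex.normSq_apply, Complex.add_re, Complex.add_im]
  nlinarith [sq_nonneg (a.re - b.re), sq_nonneg (a.im - b.im)]

lemma fsq_add_le (M N : Matrix m n ℂ) : fsq (M + N) ≤ 2 * fsq M + 2 * fsq N := by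
  simp only [fsq, Finset.mul_sum, ← Finset.sum_add_distrib]
  exact Finset.sum_le_sum fun _ _ => Finset.sum_le_sum fun _ _ => normSq_add_le _ _

lemma fsq_mul (K : Matrix r m ℂ) (M : Matrix m n ℂ) :
    fsq (K * M) = (trace (Mᴴ * (Kᴴ * K) * M)).re := by
  rw [fsq_eq, conjTranspose_mul]
  simp only [Matrix.mul_assoc]

variable [DecidableEq m] [DecidableEq d] [DecidableEq n] [DecidableEq r]

/-- Contractions. -/
def Contr (U : Matrix m n ℂ) : Prop := (1 - Uᴴ * U).PosSemidef

lemma Contr.fsq_le {U : Matrix m n ℂ} (hU : Contr U) (M : Matrix n r ℂ) : fsq (U * M) ≤ fsq M := by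
  have h := (Complex.le_def.mp (hU.conjTranspose_mul_mul_same M).trace_nonneg).1
  rw [fsq_mul, fsq_eq]
  rw [Matrix.mul_sub, Matrix.sub_mul, trace_sub, Matrix.mul_one] at h
  simpa using h

lemma Contr.mul {U : Matrix m n ℂ} {W : Matrix n r ℂ} (hU : Contr U) (hW : Contr W) :
    Contr (U * W) := by
  have : 1 - (U * W)ᴴ * (U * W) = (1 - Wᴴ * W) + Wᴴ * (1 - Uᴴ * U) * W := by
    rw [conjTranspose_mul, Matrix.mul_sub, Matrix.sub_mul, Matrix.mul_one]
    simp only [Matrix.mul_assoc]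
    abel
  unfold Contr
  rw [this]
  exact hW.add (hU.conjTranspose_mul_mul_same W)

lemma proj_psd {E : Matrix m m ℂ} (h1 : Eᴴ = E) (h2 : E * E = E) : (1 - E).PosSemidef := by
  have : 1 - E = (1 - E)ᴴ * (1 - E) := by
    rw [conjTranspose_sub, conjTranspose_one, h1, Matrix.sub_mul, Matrix.mul_sub, Matrix.mul_sub, h2]
    simp
  rw [this]
  exact posSemidef_conjTranspose_mul_self _

lemma cfc_herm (f : ℝ → ℝ) (S : Matrix d d ℂ) : (cfc f S)ᴴ = cfc f S := by
  have : IsSelfAdjoint (cfc f S) := cfc_predicate f S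
  exact this

lemma cfc_sqrt_sq {S : Matrix d d ℂ} (hS : S.PosSemidef) :
    (cfc Real.sqrt S)ᴴ * cfc Real.sqrt S = S := by
  rw [cfc_herm, ← cfc_mul Real.sqrt Real.sqrt S (contOn_spec _ _) (contOn_spec _ _)]
  conv_rhs => rw [← cfc_id' ℝ S hS.isHermitian.isSelfAdjoint]
  refine cfc_congr fun t ht => ?_
  have : 0 ≤ t := by
    rw [hS.isHermitian.spectrum_real_eq_range_eigenvalues] at ht
    obtain ⟨i, rfl⟩ := ht
    exact hS.eigenvalues_nonneg i
  exact Real.mul_self_sqrt this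

lemma polar (N : Matrix r d ℂ) : ∃ W : Matrix r d ℂ, Contr W ∧ Contr Wᴴ ∧
    Wᴴ * N = cfc Real.sqrt (Nᴴ * N) := by
  set H := Nᴴ * N with hH
  have hHp : H.PosSemidef := posSemidef_conjTranspose_mul_self N
  set g : ℝ → ℝ := fun t => (Real.sqrt t)⁻¹ with hg
  have hid : cfc (fun t : ℝ => t) H = H := cfc_id' ℝ H hHp.isHermitian.isSelfAdjoint
  have mulc : ∀ f h : ℝ → ℝ, cfc f H * cfc h H = cfc (fun t => f t * h t) H := fun f h =>
    (cfc_mul f h H (contOn_spec _ _) (contOn_spec _ _)).symm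
  have hWN : (N * cfc g H)ᴴ * N = cfc Real.sqrt H := by
    rw [conjTranspose_mul, cfc_herm, Matrix.mul_assoc, ← hH]
    nth_rewrite 2 [← hid]
    rw [mulc]
    congr 1
    funext t
    rw [hg]
    simp only
    rw [inv_mul_eq_div, Real.div_sqrt]
  have hWW : (N * cfc g H)ᴴ * (N * cfc g H) = cfc (fun t => Real.sqrt t * g t) H := by
    rw [← Matrix.mul_assoc, hWN, mulc]
  have hcube : ∀ t : ℝ, g t * (Real.sqrt t * g t) = g t := by
    intro t
    by_cases h : Real.sqrt t = 0
    · simp [hg, h]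
    · simp only [hg]; field_simp
  have hWP : (N * cfc g H) * ((N * cfc g H)ᴴ * (N * cfc g H)) = N * cfc g H := by
    rw [hWW, Matrix.mul_assoc, mulc]
    simp only [hcube]
  refine ⟨N * cfc g H, proj_psd ?_ ?_, proj_psd ?_ ?_, hWN⟩
  · rw [conjTranspose_mul, conjTranspose_conjTranspose]
  · rw [Matrix.mul_assoc, hWP]
  · rw [conjTranspose_mul, conjTranspose_conjTranspose]
  · rw [conjTranspose_conjTranspose]
    rw [← Matrix.mul_assoc, Matrix.mul_assoc (N * cfc g H), hWP]

lemma affE_zero (S T : Matrix d d ℂ) :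
    affE 0 S T = (trace (cfc Real.sqrt S * cfc Real.sqrt T)).re := by
  simp only [affE, add_zero]

lemma fsq_sub (M N : Matrix m n ℂ) : fsq (M - N) = fsq M + fsq N - 2 * (trace (Mᴴ * N)).re := by
  have h : (trace (Nᴴ * M)).re = (trace (Mᴴ * N)).re := by
    have : Nᴴ * M = (Mᴴ * N)ᴴ := by simp
    rw [this, trace_conjTranspose]
    simp
  rw [fsq_eq, fsq_eq, fsq_eq, conjTranspose_sub, Matrix.sub_mul, Matrix.mul_sub, Matrix.mul_sub]
  simp only [trace_sub, Complex.sub_re, h]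
  ring

/-- Uhlmann type statement: a contraction aligning two vectors. -/
lemma align (N' N : Matrix r d ℂ) (M : Matrix d n ℂ) : ∃ U : Matrix r r ℂ, Contr U ∧
    fsq ((N' - U * N) * M) ≤ (trace (Mᴴ * (N'ᴴ * N') * M)).re + (trace (Mᴴ * (Nᴴ * N) * M)).re
      - 2 * affE 0 (Mᴴ * (N'ᴴ * N') * M) (Mᴴ * (Nᴴ * N) * M) := by
  obtain ⟨W', h1', h2', h3'⟩ := polar (N' * M)
  obtain ⟨W, h1, h2, h3⟩ := polar (N * M)
  refine ⟨W' * Wᴴ, h1'.mul h2, ?_⟩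
  have e1 : (N' * M)ᴴ * (N' * M) = Mᴴ * (N'ᴴ * N') * M := by
    rw [conjTranspose_mul]; simp only [Matrix.mul_assoc]
  have e2 : (N * M)ᴴ * (N * M) = Mᴴ * (Nᴴ * N) * M := by
    rw [conjTranspose_mul]; simp only [Matrix.mul_assoc]
  rw [Matrix.sub_mul, fsq_sub, ← fsq_mul, ← fsq_mul, affE_zero]
  have h4 : fsq (W' * Wᴴ * N * M) ≤ fsq (N * M) := by
    rw [Matrix.mul_assoc]
    exact (h1'.mul h2).fsq_le _
  have h5 : (N' * M)ᴴ * (W' * Wᴴ * N * M) =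
      cfc Real.sqrt (Mᴴ * (N'ᴴ * N') * M) * cfc Real.sqrt (Mᴴ * (Nᴴ * N) * M) := by
    rw [← e1, ← e2, ← h3, ← cfc_herm, ← h3']
    simp only [conjTranspose_mul, conjTranspose_conjTranspose, Matrix.mul_assoc]
  rw [h5]
  linarith

lemma contr_blockDiagonal {o : Type*} [Fintype o] [DecidableEq o] {U : o → Matrix m m ℂ}
    (hU : ∀ i, Contr (U i)) : Contr (blockDiagonal U) := by
  have hR : ∀ i, ∃ R : Matrix m m ℂ, 1 - (U i)ᴴ * U i = Rᴴ * R := by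
    intro i
    exact ⟨_, (cfc_sqrt_sq (hU i)).symm⟩
  choose R hR using hR
  unfold Contr
  have : 1 - (blockDiagonal U)ᴴ * blockDiagonal U = (blockDiagonal R)ᴴ * blockDiagonal R := by
    rw [blockDiagonal_conjTranspose, ← blockDiagonal_mul, ← blockDiagonal_one,
      ← blockDiagonal_sub, blockDiagonal_conjTranspose, ← blockDiagonal_mul]
    congr 1
    funext i
    exact hR i
  rw [this]
  exact posSemidef_conjTranspose_mul_self _

end Frob

section Stack
variable {o J d n m l o' : Type*} [Fintype o] [Fintype J] [Fintype d] [Fintype n] [Fintype m] [Fintype l]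
  [Fintype o']

/-- Weighted vertical stacking of matrices. -/
def stack (w : o → ℝ) (N : o → Matrix J d ℂ) : Matrix (J × o) d ℂ :=
  fun r c => ((Real.sqrt (w r.2) : ℝ) : ℂ) * N r.2 r.1 c

lemma stack_mul (w : o → ℝ) (N : o → Matrix J d ℂ) (M : Matrix d n ℂ) :
    stack w N * M = stack w (fun x => N x * M) := by
  ext r c
  simp only [stack, Matrix.mul_apply, Finset.mul_sum, mul_assoc]

lemma stack_sub (w : o → ℝ) (N N' : o → Matrix J d ℂ) :
    stack w N - stack w N' = stack w (fun x => N x - N' x) := by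
  ext r c
  simp only [stack, Matrix.sub_apply, mul_sub]

lemma normSq_sqrt_mul {w : ℝ} (hw : 0 ≤ w) (z : ℂ) :
    Complex.normSq (((Real.sqrt w : ℝ) : ℂ) * z) = w * Complex.normSq z := by
  rw [Complex.normSq_mul, Complex.normSq_ofReal, Real.mul_self_sqrt hw]

lemma fsq_stack {w : o → ℝ} (hw : ∀ x, 0 ≤ w x) (N : o → Matrix J d ℂ) :
    fsq (stack w N) = ∑ x, w x * fsq (N x) := by
  simp only [fsq, stack, normSq_sqrt_mul (hw _), Finset.mul_sum]
  rw [Fintype.sum_prod_type, Finset.sum_comm]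

lemma stack_gram {w : o → ℝ} (hw : ∀ x, 0 ≤ w x) (N : o → Matrix J d ℂ) :
    (stack w N)ᴴ * stack w N = ∑ x, w x • ((N x)ᴴ * N x) := by
  ext i j
  rw [Matrix.mul_apply, Matrix.sum_apply, Fintype.sum_prod_type, Finset.sum_comm]
  refine Finset.sum_congr rfl fun x _ => ?_
  rw [Matrix.smul_apply, Matrix.mul_apply, Finset.smul_sum]
  refine Finset.sum_congr rfl fun y _ => ?_
  simp only [stack, Matrix.conjTranspose_apply, star_mul', Complex.real_smul]
  have : ((w x : ℝ) : ℂ) = ((Real.sqrt (w x) : ℝ) : ℂ) * ((Real.sqrt (w x) : ℝ) : ℂ) := by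
    rw [← Complex.ofReal_mul, Real.mul_self_sqrt (hw x)]
  rw [this, Complex.star_def, Complex.conj_ofReal]
  ring

variable [DecidableEq o]

lemma blockDiagonal_stack (w : o → ℝ) (U : o → Matrix J J ℂ) (N : o → Matrix J d ℂ) :
    blockDiagonal U * stack w N = stack w (fun x => U x * N x) := by
  ext r c
  obtain ⟨j, x⟩ := r
  rw [Matrix.mul_apply, Fintype.sum_prod_type]
  simp only [stack, blockDiagonal_apply, Matrix.mul_apply, Finset.mul_sum]
  refine Finset.sum_congr rfl fun j' _ => ?_
  simp
  ring

end Stack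

section Side
variable {X Ω d n : Type*} [Fintype X] [Fintype Ω] [Fintype d] [Fintype n] {k : ℕ}
  [DecidableEq X] [DecidableEq Ω] [DecidableEq d] [DecidableEq n]

/-- Block of square roots of a POVM along a reparametrisation `g` of the questions. -/
def NB (μ : X → ℝ) (F : (Fin k → X) → Ω → Matrix d d ℂ) (g : (Fin k → X) → (Fin k → X)) :
    Matrix ((d × Ω) × (Fin k → X)) d ℂ :=
  stack (wt μ) (fun x' => stack (fun _ => 1) (fun a => cfc Real.sqrt (F (g x') a)))

/-- Unconditioned square root operator. -/
def K0 (μ : X → ℝ) (F : (Fin k → X) → Ω → Matrix d d ℂ) (i : Fin k) :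
    Matrix (((d × Ω) × (Fin k → X)) × (Fin k → X)) d ℂ :=
  stack (wt μ) (fun x => NB μ F (fun x' => ov (fun j => j.val < i.val) x x'))

/-- Square root operator conditioned on coordinate `i` having the value `s`. -/
def K1 (μ : X → ℝ) (F : (Fin k → X) → Ω → Matrix d d ℂ) (i : Fin k) (s : X) :
    Matrix (((d × Ω) × (Fin k → X)) × (Fin k → X)) d ℂ :=
  stack (wt μ) (fun x => NB μ F (fun x' => Function.update (ov (fun j => j.val < i.val) x x') i s))

lemma NB_gram {μ : X → ℝ} (h0 : ∀ x, 0 ≤ μ x) {F : (Fin k → X) → Ω → Matrix d d ℂ}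
    (hF : ∀ x a, (F x a).PosSemidef) (g : (Fin k → X) → (Fin k → X)) :
    (NB μ F g)ᴴ * NB μ F g = ∑ x', wt μ x' • ∑ a, F (g x') a := by
  rw [NB, stack_gram (wt_nonneg h0)]
  refine Finset.sum_congr rfl fun x _ => ?_
  rw [stack_gram (fun _ => zero_le_one)]
  simp only [cfc_sqrt_sq (hF _ _), one_smul]

lemma NB_gram0 {μ : X → ℝ} (h0 : ∀ x, 0 ≤ μ x) {F : (Fin k → X) → Ω → Matrix d d ℂ}
    (hF : ∀ x a, (F x a).PosSemidef) (i : Fin k) (x : Fin k → X) :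
    (NB μ F (fun x' => ov (fun j => j.val < i.val) x x'))ᴴ * NB μ F (fun x' => ov (fun j => j.val < i.val) x x') =
      cavg μ i.val (fun x => ∑ a, F x a) x := by
  rw [NB_gram h0 hF, cavg]

lemma NB_gram1 {μ : X → ℝ} (h0 : ∀ x, 0 ≤ μ x) {F : (Fin k → X) → Ω → Matrix d d ℂ}
    (hF : ∀ x a, (F x a).PosSemidef) (i : Fin k) (s : X) (x : Fin k → X) :
    (NB μ F (fun x' => Function.update (ov (fun j => j.val < i.val) x x') i s))ᴴ *
      NB μ F (fun x' => Function.update (ov (fun j => j.val < i.val) x x') i s) =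
      cavg μ (i.val + 1) (fun x => ∑ a, F x a) (Function.update x i s) := by
  rw [NB_gram h0 hF, cavg]
  simp only [ov_upd_left]

lemma sum_cavg {E : Type*} [AddCommGroup E] [Module ℝ E] {μ : X → ℝ} (h1 : ∑ x, μ x = 1)
    (j : ℕ) (S : (Fin k → X) → E) :
    ∑ x, wt μ x • cavg μ j S x = ∑ x, wt μ x • S x := by
  simp only [cavg, Finset.smul_sum, smul_smul]
  exact resample h1 _ S

lemma K0_gram {μ : X → ℝ} (h0 : ∀ x, 0 ≤ μ x) (h1 : ∑ x, μ x = 1)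
    {F : (Fin k → X) → Ω → Matrix d d ℂ} (hF : ∀ x a, (F x a).PosSemidef) (i : Fin k) :
    (K0 μ F i)ᴴ * K0 μ F i = ∑ x, wt μ x • ∑ a, F x a := by
  rw [K0, stack_gram (wt_nonneg h0)]
  simp only [NB_gram0 h0 hF]
  exact sum_cavg h1 _ _

lemma K1_gram {μ : X → ℝ} (h0 : ∀ x, 0 ≤ μ x) (h1 : ∑ x, μ x = 1)
    {F : (Fin k → X) → Ω → Matrix d d ℂ} (hF : ∀ x a, (F x a).PosSemidef) (i : Fin k) :
    ∑ s, μ s • ((K1 μ F i s)ᴴ * K1 μ F i s) = ∑ x, wt μ x • ∑ a, F x a := by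
  simp only [K1, stack_gram (wt_nonneg h0), NB_gram1 h0 hF, Finset.smul_sum]
  rw [Finset.sum_comm]
  simp only [smul_comm (μ _) (wt μ _), ← Finset.smul_sum, cavg_step h1]
  rw [sum_cavg h1]

lemma conj_cavg (μ : X → ℝ) (S : (Fin k → X) → Matrix d d ℂ) (M : Matrix d n ℂ) (j : ℕ) (x : Fin k → X) :
    Mᴴ * cavg μ j S x * M = cavg μ j (fun x => Mᴴ * S x * M) x := by
  simp only [cavg, Matrix.mul_sum, Matrix.sum_mul, Matrix.mul_smul, Matrix.smul_mul]

/-- One sided alignment lemma. -/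
lemma side {μ : X → ℝ} (h0 : ∀ x, 0 ≤ μ x) (h1 : ∑ x, μ x = 1)
    {F : (Fin k → X) → Ω → Matrix d d ℂ} (hF : ∀ x a, (F x a).PosSemidef)
    (hF1 : ∀ x, (1 - ∑ a, F x a).PosSemidef) (M : Matrix d n ℂ) (hM : fsq M ≤ 1) :
    ∃ U : Fin k → X → Matrix (((d × Ω) × (Fin k → X)) × (Fin k → X)) (((d × Ω) × (Fin k → X)) × (Fin k → X)) ℂ,
      (∀ i s, Contr (U i s)) ∧
      ∑ i, ∑ s, μ s * fsq ((K1 μ F i s - U i s * K0 μ F i) * M) ≤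
        Real.negMulLog (trace (Mᴴ * (∑ x, wt μ x • ∑ a, F x a) * M)).re := by
  have hal := fun (i : Fin k) (s : X) (x : Fin k → X) =>
    align (NB μ F (fun x' => Function.update (ov (fun j => j.val < i.val) x x') i s))
      (NB μ F (fun x' => ov (fun j => j.val < i.val) x x')) M
  choose U hU hUb using hal
  refine ⟨fun i s => blockDiagonal (U i s), fun i s => contr_blockDiagonal (hU i s), ?_⟩
  set S : (Fin k → X) → Matrix n n ℂ := fun x => Mᴴ * (∑ a, F x a) * M with hS
  have hSp : ∀ x, (S x).PosSemidef := fun x =>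
    (posSemidef_sum _ fun a _ => hF x a).conjTranspose_mul_mul_same M
  have hST : ∀ x, (Mᴴ * M - S x).PosSemidef := fun x => by
    have := (hF1 x).conjTranspose_mul_mul_same M
    rwa [Matrix.mul_sub, Matrix.sub_mul, Matrix.mul_one] at this
  have hb := ent_bound h0 h1 hSp (posSemidef_conjTranspose_mul_self M) (by rwa [← fsq_eq]) hST
  have e : Mᴴ * (∑ x, wt μ x • ∑ a, F x a) * M = ∑ x, wt μ x • S x := by
    simp only [hS, Matrix.mul_sum, Matrix.sum_mul, Matrix.mul_smul, Matrix.smul_mul]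
  rw [e]
  refine le_trans (Finset.sum_le_sum fun i _ => ?_) hb
  have step : ∀ s, fsq ((K1 μ F i s - blockDiagonal (U i s) * K0 μ F i) * M) ≤
      ∑ x, wt μ x * ((trace (cavg μ (i.val + 1) S (Function.update x i s))).re
        + (trace (cavg μ i.val S x)).re
        - 2 * affE 0 (cavg μ (i.val + 1) S (Function.update x i s)) (cavg μ i.val S x)) := by
    intro s
    rw [K1, K0, blockDiagonal_stack, stack_sub, stack_mul, fsq_stack (wt_nonneg h0)]
    refine Finset.sum_le_sum fun x _ => mul_le_mul_of_nonneg_left ?_ (wt_nonneg h0 x)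
    have := hUb i s x
    rw [NB_gram0 h0 hF, NB_gram1 h0 hF, conj_cavg, conj_cavg] at this
    exact this
  refine (Finset.sum_le_sum fun s _ => mul_le_mul_of_nonneg_left (step s) (h0 s)).trans ?_
  simp only [Finset.mul_sum]
  rw [Finset.sum_comm]
  refine Finset.sum_le_sum fun x _ => ?_
  have hst : ∑ s, μ s * (trace (cavg μ (i.val + 1) S (Function.update x i s))).re =
      (trace (cavg μ i.val S x)).re := by
    rw [← cavg_step h1, trace_sum, Complex.re_sum]
    refine Finset.sum_congr rfl fun s _ => ?_
    rw [trace_smul, Complex.smul_re, smul_eq_mul]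
  have hst2 : ∑ s, μ s * (trace (cavg μ i.val S x)).re = (trace (cavg μ i.val S x)).re := by
    rw [← Finset.sum_mul, h1, one_mul]
  have : ∑ s, μ s * ((trace (cavg μ (i.val + 1) S (Function.update x i s))).re
        + (trace (cavg μ i.val S x)).re
        - 2 * affE 0 (cavg μ (i.val + 1) S (Function.update x i s)) (cavg μ i.val S x)) =
      ∑ s, μ s * (2 * (trace (cavg μ (i.val + 1) S (Function.update x i s))).re
        - 2 * affE 0 (cavg μ (i.val + 1) S (Function.update x i s)) (cavg μ i.val S x)) := by
    simp only [mul_sub, mul_add, Finset.sum_add_distrib, Finset.sum_sub_distrib]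
    rw [hst2]
    simp only [mul_left_comm (μ _) 2, ← Finset.mul_sum, hst]
    ring
  simp only [mul_left_comm (μ _) (wt μ x), ← Finset.mul_sum]
  rw [this]

end Side

section Br
variable {m n p q : Type*} [Fintype m] [Fintype n] [Fintype p] [Fintype q]

/-- The quadratic form of a product operator. -/
def br (ψ : m × n → ℂ) (P : Matrix m m ℂ) (Q : Matrix n n ℂ) : ℝ :=
  (star ψ ⬝ᵥ ((P ⊗ₖ Q) *ᵥ ψ)).re

/-- A bipartite vector as a matrix. -/
def vmat (ψ : m × n → ℂ) : Matrix m n ℂ := fun i j => ψ (i, j)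

lemma kron_vec (ψ : m × n → ℂ) (P : Matrix p m ℂ) (Q : Matrix q n ℂ) (r : p) (c : q) :
    ((P ⊗ₖ Q) *ᵥ ψ) (r, c) = (P * vmat ψ * Qᵀ) r c := by
  rw [Matrix.mulVec, dotProduct, Fintype.sum_prod_type, Matrix.mul_apply, Finset.sum_comm]
  refine Finset.sum_congr rfl fun j _ => ?_
  rw [Matrix.mul_apply, Finset.sum_mul]
  refine Finset.sum_congr rfl fun i _ => ?_
  simp only [kroneckerMap_apply, vmat, transpose_apply]
  ring

lemma br_fsq (ψ : m × n → ℂ) (P : Matrix p m ℂ) (Q : Matrix q n ℂ) :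
    br ψ (Pᴴ * P) (Qᴴ * Q) = fsq (P * vmat ψ * Qᵀ) := by
  have h1 : (Pᴴ * P) ⊗ₖ (Qᴴ * Q) = (P ⊗ₖ Q)ᴴ * (P ⊗ₖ Q) := by
    rw [conjTranspose_kronecker, mul_kronecker_mul]
  rw [br, h1, ← Matrix.mulVec_mulVec, Matrix.dotProduct_mulVec, ← Matrix.star_mulVec, dotProduct,
    Complex.re_sum, Fintype.sum_prod_type, fsq]
  refine Finset.sum_congr rfl fun r _ => Finset.sum_congr rfl fun c _ => ?_
  rw [Pi.star_apply, kron_vec]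
  simp [Complex.normSq_apply]

lemma br_one [DecidableEq m] [DecidableEq n] (ψ : m × n → ℂ) : br ψ 1 1 = fsq (vmat ψ) := by
  have := br_fsq ψ (1 : Matrix m m ℂ) (1 : Matrix n n ℂ)
  simpa using this

lemma br_add_left (ψ : m × n → ℂ) (P P' : Matrix m m ℂ) (Q : Matrix n n ℂ) :
    br ψ (P + P') Q = br ψ P Q + br ψ P' Q := by
  simp only [br, add_kronecker, Matrix.add_mulVec, dotProduct_add, Complex.add_re]

lemma br_add_right (ψ : m × n → ℂ) (P : Matrix m m ℂ) (Q Q' : Matrix n n ℂ) :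
    br ψ P (Q + Q') = br ψ P Q + br ψ P Q' := by
  simp only [br, kronecker_add, Matrix.add_mulVec, dotProduct_add, Complex.add_re]

lemma br_smul_left (ψ : m × n → ℂ) (c : ℝ) (P : Matrix m m ℂ) (Q : Matrix n n ℂ) :
    br ψ (c • P) Q = c * br ψ P Q := by
  simp only [br, smul_kronecker, Matrix.smul_mulVec, dotProduct_smul, Complex.smul_re, smul_eq_mul]

lemma br_smul_right (ψ : m × n → ℂ) (c : ℝ) (P : Matrix m m ℂ) (Q : Matrix n n ℂ) :
    br ψ P (c • Q) = c * br ψ P Q := by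
  simp only [br, kronecker_smul, Matrix.smul_mulVec, dotProduct_smul, Complex.smul_re, smul_eq_mul]

lemma br_sum_left {ι : Type*} (s : Finset ι) (ψ : m × n → ℂ) (P : ι → Matrix m m ℂ) (Q : Matrix n n ℂ) :
    br ψ (∑ i ∈ s, P i) Q = ∑ i ∈ s, br ψ (P i) Q := by
  classical
  induction s using Finset.induction_on with
  | empty => simp [br]
  | insert a s ha ih => rw [Finset.sum_insert ha, Finset.sum_insert ha, br_add_left, ih]

lemma br_sum_right {ι : Type*} (s : Finset ι) (ψ : m × n → ℂ) (P : Matrix m m ℂ) (Q : ι → Matrix n n ℂ) :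
    br ψ P (∑ i ∈ s, Q i) = ∑ i ∈ s, br ψ P (Q i) := by
  classical
  induction s using Finset.induction_on with
  | empty => simp [br]
  | insert a s ha ih => rw [Finset.sum_insert ha, Finset.sum_insert ha, br_add_right, ih]

lemma br_nonneg (ψ : m × n → ℂ) {P : Matrix m m ℂ} {Q : Matrix n n ℂ} (hP : P.PosSemidef)
    (hQ : Q.PosSemidef) : 0 ≤ br ψ P Q := by
  classical
  rw [← cfc_sqrt_sq hP, ← cfc_sqrt_sq hQ, br_fsq]
  exact fsq_nonneg _

lemma br_smul_vec (ψ : m × n → ℂ) (c : ℝ) (P : Matrix m m ℂ) (Q : Matrix n n ℂ) :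
    br (c • ψ) P Q = c ^ 2 * br ψ P Q := by
  simp only [br, Matrix.mulVec_smul, dotProduct_smul, star_smul, smul_dotProduct, Complex.smul_re,
    smul_eq_mul, star_trivial]
  ring

lemma star_dot_self (ψ : m × n → ℂ) : (star ψ ⬝ᵥ ψ).re = fsq (vmat ψ) := by
  rw [dotProduct, Complex.re_sum, Fintype.sum_prod_type, fsq]
  refine Finset.sum_congr rfl fun r _ => Finset.sum_congr rfl fun c _ => ?_
  simp [vmat, Complex.normSq_apply]

lemma star_dot_self' (ψ : m × n → ℂ) : star ψ ⬝ᵥ ψ = ((fsq (vmat ψ) : ℝ) : ℂ) := by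
  apply Complex.ext
  · rw [star_dot_self, Complex.ofReal_re]
  · rw [Complex.ofReal_im, dotProduct, Complex.im_sum]
    refine Finset.sum_eq_zero fun i _ => ?_
    simp
    ring

lemma br_reindex (ψ : m × n → ℂ) (e : p ≃ m) (f : q ≃ n) (P : Matrix m m ℂ) (Q : Matrix n n ℂ) :
    br (fun z : p × q => ψ (e z.1, f z.2)) (P.submatrix e e) (Q.submatrix f f) = br ψ P Q := by
  unfold br
  congr 1
  simp only [dotProduct, Matrix.mulVec]
  refine Fintype.sum_equiv (Equiv.prodCongr e f) _ _ fun z => ?_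
  congr 1
  refine Fintype.sum_equiv (Equiv.prodCongr e f) _ _ fun z' => ?_
  rfl

end Br

section Val
variable {X Y A B : Type} [Fintype X] [Fintype Y] [Fintype A] [Fintype B]

lemma winProb_eq_br (G : Game X Y A B) {dA dB : ℕ} (ψ : Fin dA × Fin dB → ℂ)
    (Al : X → A → Matrix (Fin dA) (Fin dA) ℂ) (Bo : Y → B → Matrix (Fin dB) (Fin dB) ℂ) :
    winProb G ψ Al Bo = ∑ x, ∑ y, ∑ a, ∑ b,
      G.μ (x, y) * (if G.V x y a b then 1 else 0) * br ψ (Al x a) (Bo y b) := rfl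

lemma winProb_le_one (G : Game X Y A B) (hμ0 : ∀ p, 0 ≤ G.μ p) (hμ1 : ∑ p : X × Y, G.μ p = 1)
    {dA dB : ℕ} (ψ : Fin dA × Fin dB → ℂ)
    (Al : X → A → Matrix (Fin dA) (Fin dA) ℂ) (Bo : Y → B → Matrix (Fin dB) (Fin dB) ℂ)
    (hψ : star ψ ⬝ᵥ ψ = 1)
    (h1 : ∀ x a, (Al x a).PosSemidef) (h2 : ∀ x, ∑ a : A, Al x a = 1)
    (h3 : ∀ y b, (Bo y b).PosSemidef) (h4 : ∀ y, ∑ b : B, Bo y b = 1) : winProb G ψ Al Bo ≤ 1 := by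
  have hs : ∀ x y, ∑ a, ∑ b, br ψ (Al x a) (Bo y b) = 1 := by
    intro x y
    simp only [← br_sum_right, h4, ← br_sum_left, h2]
    rw [br_one, ← star_dot_self, hψ, Complex.one_re]
  calc winProb G ψ Al Bo ≤ ∑ x, ∑ y, ∑ a, ∑ b, G.μ (x, y) * br ψ (Al x a) (Bo y b) := by
        rw [winProb_eq_br]
        refine Finset.sum_le_sum fun x _ => Finset.sum_le_sum fun y _ => Finset.sum_le_sum fun a _ =>
          Finset.sum_le_sum fun b _ => ?_
        refine mul_le_mul_of_nonneg_right ?_ (br_nonneg ψ (h1 x a) (h3 y b))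
        have := hμ0 (x, y)
        split_ifs <;> simp [this]
    _ = 1 := by
        simp only [← Finset.mul_sum, hs, mul_one]
        rw [← hμ1, Fintype.sum_prod_type]

lemma val_le_one (G : Game X Y A B) (hμ0 : ∀ p, 0 ≤ G.μ p) (hμ1 : ∑ p : X × Y, G.μ p = 1) :
    entangledValue G ≤ 1 := by
  refine Real.sSup_le ?_ zero_le_one
  rintro p ⟨dA, dB, ψ, Al, Bo, hψ, h1, h2, h3, h4, rfl⟩
  exact winProb_le_one G hμ0 hμ1 ψ Al Bo hψ h1 h2 h3 h4

lemma winProb_le_val (G : Game X Y A B) (hμ0 : ∀ p, 0 ≤ G.μ p) (hμ1 : ∑ p : X × Y, G.μ p = 1)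
    {dA dB : ℕ} (ψ : Fin dA × Fin dB → ℂ)
    (Al : X → A → Matrix (Fin dA) (Fin dA) ℂ) (Bo : Y → B → Matrix (Fin dB) (Fin dB) ℂ)
    (hψ : star ψ ⬝ᵥ ψ = 1)
    (h1 : ∀ x a, (Al x a).PosSemidef) (h2 : ∀ x, ∑ a : A, Al x a = 1)
    (h3 : ∀ y b, (Bo y b).PosSemidef) (h4 : ∀ y, ∑ b : B, Bo y b = 1) :
    winProb G ψ Al Bo ≤ entangledValue G := by
  refine le_csSup ⟨1, ?_⟩ ⟨dA, dB, ψ, Al, Bo, hψ, h1, h2, h3, h4, rfl⟩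
  rintro p ⟨dA, dB, ψ, Al, Bo, hψ, h1, h2, h3, h4, rfl⟩
  exact winProb_le_one G hμ0 hμ1 ψ Al Bo hψ h1 h2 h3 h4

/-- The value bounds every strategy, on arbitrary finite index types and unnormalised vectors. -/
lemma general_le_val (G : Game X Y A B) (hμ0 : ∀ p, 0 ≤ G.μ p) (hμ1 : ∑ p : X × Y, G.μ p = 1)
    {m n : Type*} [Fintype m] [Fintype n] [DecidableEq m] [DecidableEq n] (ψ : m × n → ℂ)
    (Al : X → A → Matrix m m ℂ) (Bo : Y → B → Matrix n n ℂ)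
    (h1 : ∀ x a, (Al x a).PosSemidef) (h2 : ∀ x, ∑ a : A, Al x a = 1)
    (h3 : ∀ y b, (Bo y b).PosSemidef) (h4 : ∀ y, ∑ b : B, Bo y b = 1) :
    ∑ x, ∑ y, ∑ a, ∑ b, G.μ (x, y) * (if G.V x y a b then 1 else 0) * br ψ (Al x a) (Bo y b) ≤
      entangledValue G * fsq (vmat ψ) := by
  rcases (fsq_nonneg (vmat ψ)).eq_or_lt with h0 | hpos
  · have hz : ψ = 0 := by
      have := star_dot_self' ψ
      rw [← h0, Complex.ofReal_zero] at this
      exact dotProduct_star_self_eq_zero.mp this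
    rw [← h0, mul_zero]
    refine le_of_eq ?_
    subst hz
    simp [br]
  · set N := fsq (vmat ψ) with hN
    set c : ℝ := (Real.sqrt N)⁻¹ with hc
    have hc2 : c ^ 2 * N = 1 := by
      rw [hc, inv_pow, Real.sq_sqrt hpos.le, inv_mul_cancel₀ hpos.ne']
    let e := (Fintype.equivFin m).symm
    let f := (Fintype.equivFin n).symm
    have hψ' : star (fun z : Fin (Fintype.card m) × Fin (Fintype.card n) => (c • ψ) (e z.1, f z.2)) ⬝ᵥ
        (fun z : Fin (Fintype.card m) × Fin (Fintype.card n) => (c • ψ) (e z.1, f z.2)) = 1 := by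
      rw [star_dot_self', ← br_one]
      have := br_reindex (c • ψ) e f 1 1
      rw [submatrix_one_equiv, submatrix_one_equiv] at this
      rw [this, br_smul_vec, br_one, ← hN, hc2, Complex.ofReal_one]
    have key := winProb_le_val G hμ0 hμ1
      (fun z : Fin (Fintype.card m) × Fin (Fintype.card n) => (c • ψ) (e z.1, f z.2))
      (fun x a => (Al x a).submatrix e e) (fun y b => (Bo y b).submatrix f f) hψ'
      (fun x a => (h1 x a).submatrix e)
      (fun x => by
        have := congrArg (fun M => M.submatrix e e) (h2 x)
        simp only [submatrix_one_equiv] at this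
        rw [← this]
        ext i j
        simp [Matrix.sum_apply])
      (fun y b => (h3 y b).submatrix f)
      (fun y => by
        have := congrArg (fun M => M.submatrix f f) (h4 y)
        simp only [submatrix_one_equiv] at this
        rw [← this]
        ext i j
        simp [Matrix.sum_apply])
    rw [winProb_eq_br] at key
    simp only [br_reindex, br_smul_vec] at key
    simp only [mul_left_comm _ (c ^ 2), ← Finset.mul_sum] at key
    have := mul_le_mul_of_nonneg_right key hpos.le
    rw [mul_right_comm, hc2, one_mul] at this
    exact this

/-- The label projections. -/
def lproj {m A : Type*} [DecidableEq m] [DecidableEq A] (la : m → A) (a : A) : Matrix m m ℂ :=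
  diagonal fun r => if la r = a then 1 else 0

lemma lproj_gram {m A : Type*} [Fintype m] [DecidableEq m] [DecidableEq A] (la : m → A) (a : A) :
    (lproj la a)ᴴ * lproj la a = lproj la a := by
  rw [lproj, diagonal_conjTranspose, diagonal_mul_diagonal]
  congr 1
  funext r
  by_cases h : la r = a <;> simp [h]

lemma lproj_sum {m A : Type*} [Fintype A] [DecidableEq m] [DecidableEq A] (la : m → A) :
    ∑ a, lproj la a = 1 := by
  ext i j
  rw [Matrix.sum_apply]
  by_cases h : i = j
  · subst h
    simp [lproj]
  · simp [lproj, h]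

/-- POVM obtained from a contraction followed by reading a label. -/
def labPovm {m A : Type*} [Fintype m] [DecidableEq m] [DecidableEq A] (la : m → A) (a0 : A)
    (U : Matrix m m ℂ) (a : A) : Matrix m m ℂ :=
  Uᴴ * lproj la a * U + if a = a0 then 1 - Uᴴ * U else 0

lemma labPovm_main {m A : Type*} [Fintype m] [DecidableEq m] [DecidableEq A] (la : m → A)
    (U : Matrix m m ℂ) (a : A) : Uᴴ * lproj la a * U = (lproj la a * U)ᴴ * (lproj la a * U) := by
  conv_lhs => rw [← lproj_gram]
  rw [conjTranspose_mul]
  simp only [Matrix.mul_assoc]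

lemma labPovm_rem {m A : Type*} [Fintype m] [DecidableEq m] [DecidableEq A] (a a0 : A)
    {U : Matrix m m ℂ} (hU : Contr U) : (if a = a0 then 1 - Uᴴ * U else 0 : Matrix m m ℂ).PosSemidef := by
  split_ifs
  · exact hU
  · exact PosSemidef.zero

lemma labPovm_main_psd {m A : Type*} [Fintype m] [DecidableEq m] [DecidableEq A] (la : m → A)
    (U : Matrix m m ℂ) (a : A) : (Uᴴ * lproj la a * U).PosSemidef := by
  rw [labPovm_main]
  exact posSemidef_conjTranspose_mul_self _

lemma labPovm_psd {m A : Type*} [Fintype m] [DecidableEq m] [DecidableEq A] (la : m → A) (a0 : A)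
    {U : Matrix m m ℂ} (hU : Contr U) (a : A) : (labPovm la a0 U a).PosSemidef :=
  (labPovm_main_psd la U a).add (labPovm_rem a a0 hU)

lemma labPovm_sum {m A : Type*} [Fintype m] [Fintype A] [DecidableEq m] [DecidableEq A] (la : m → A) (a0 : A)
    (U : Matrix m m ℂ) : ∑ a, labPovm la a0 U a = 1 := by
  simp only [labPovm, Finset.sum_add_distrib, ← Matrix.sum_mul, ← Matrix.mul_sum, lproj_sum]
  simp

lemma fsq_lproj {m n A B : Type*} [Fintype m] [Fintype n] [DecidableEq m] [DecidableEq n]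
    [DecidableEq A] [DecidableEq B] (la : m → A) (lb : n → B) (T : Matrix m n ℂ) (a : A) (b : B) :
    fsq (lproj la a * T * (lproj lb b)ᵀ) =
      ∑ r, ∑ c, if la r = a ∧ lb c = b then Complex.normSq (T r c) else 0 := by
  refine Finset.sum_congr rfl fun r _ => Finset.sum_congr rfl fun c _ => ?_
  rw [lproj, lproj, diagonal_transpose, mul_diagonal, diagonal_mul]
  by_cases h : la r = a <;> by_cases h' : lb c = b <;> simp [h, h']

lemma sum4_comm {α β γ δ : Type*} [Fintype α] [Fintype β] [Fintype γ] [Fintype δ]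
    {E : Type*} [AddCommMonoid E] (g : α → β → γ → δ → E) :
    ∑ a, ∑ b, ∑ r, ∑ c, g a b r c = ∑ r, ∑ c, ∑ a, ∑ b, g a b r c := by
  have h1 : ∑ a, ∑ b, ∑ r, ∑ c, g a b r c = ∑ z : α × β, ∑ w : γ × δ, g z.1 z.2 w.1 w.2 := by
    simp only [Fintype.sum_prod_type]
  have h2 : ∑ r, ∑ c, ∑ a, ∑ b, g a b r c = ∑ w : γ × δ, ∑ z : α × β, g z.1 z.2 w.1 w.2 := by
    simp only [Fintype.sum_prod_type]
  rw [h1, h2, Finset.sum_comm]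

/-- Rounding a family of contractions to a strategy. -/
lemma strat_le_val [Nonempty A] [Nonempty B] (G : Game X Y A B) (hμ0 : ∀ p, 0 ≤ G.μ p)
    (hμ1 : ∑ p : X × Y, G.μ p = 1)
    {m n : Type*} [Fintype m] [Fintype n] [DecidableEq m] [DecidableEq n] (S : Matrix m n ℂ)
    (la : m → A) (lb : n → B) (U : X → Matrix m m ℂ) (W : Y → Matrix n n ℂ)
    (hU : ∀ x, Contr (U x)) (hW : ∀ y, Contr (W y)) :
    ∑ x, ∑ y, G.μ (x, y) * ∑ r, ∑ c, (if G.V x y (la r) (lb c) then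
      Complex.normSq ((U x * S * (W y)ᵀ) r c) else 0) ≤ entangledValue G * fsq S := by
  classical
  obtain ⟨a0⟩ := ‹Nonempty A›
  obtain ⟨b0⟩ := ‹Nonempty B›
  set ψ : m × n → ℂ := fun z => S z.1 z.2 with hψ
  have hv : vmat ψ = S := rfl
  have key := general_le_val G hμ0 hμ1 ψ (fun x => labPovm la a0 (U x)) (fun y => labPovm lb b0 (W y))
    (fun x => labPovm_psd la a0 (hU x)) (fun x => labPovm_sum la a0 (U x))
    (fun x => labPovm_psd lb b0 (hW x)) (fun x => labPovm_sum lb b0 (W x))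
  rw [hv] at key
  refine le_trans ?_ key
  refine Finset.sum_le_sum fun x _ => Finset.sum_le_sum fun y _ => ?_
  have hb : ∀ a b, (∑ r, ∑ c, if la r = a ∧ lb c = b then
      Complex.normSq ((U x * S * (W y)ᵀ) r c) else 0) ≤ br ψ (labPovm la a0 (U x) a) (labPovm lb b0 (W y) b) := by
    intro a b
    rw [← fsq_lproj]
    have e : lproj la a * (U x * S * (W y)ᵀ) * (lproj lb b)ᵀ =
        (lproj la a * U x) * vmat ψ * (lproj lb b * W y)ᵀ := by
      rw [hv, transpose_mul]
      simp only [Matrix.mul_assoc]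
    rw [e, ← br_fsq, ← labPovm_main, ← labPovm_main, labPovm, labPovm, br_add_left, br_add_right,
      br_add_right]
    have p1 := br_nonneg ψ (labPovm_main_psd la (U x) a) (labPovm_rem b b0 (hW y))
    have p2 := br_nonneg ψ (labPovm_rem a a0 (hU x)) (labPovm_main_psd lb (W y) b)
    have p3 := br_nonneg ψ (labPovm_rem a a0 (hU x)) (labPovm_rem b b0 (hW y))
    linarith
  have hsplit : (∑ r, ∑ c, (if G.V x y (la r) (lb c) then
      Complex.normSq ((U x * S * (W y)ᵀ) r c) else 0)) =
      ∑ a, ∑ b, (if G.V x y a b then 1 else 0) * ∑ r, ∑ c, if la r = a ∧ lb c = b then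
      Complex.normSq ((U x * S * (W y)ᵀ) r c) else 0 := by
    simp only [Finset.mul_sum]
    rw [sum4_comm]
    refine Finset.sum_congr rfl fun r _ => Finset.sum_congr rfl fun c _ => ?_
    simp [ite_and, Finset.sum_ite_eq]
  rw [hsplit, Finset.mul_sum]
  refine Finset.sum_le_sum fun a _ => ?_
  rw [Finset.mul_sum]
  refine Finset.sum_le_sum fun b _ => ?_
  rw [← mul_assoc]
  refine mul_le_mul_of_nonneg_left (hb a b) ?_
  refine mul_nonneg (hμ0 _) ?_
  split_ifs <;> norm_num

end Val

section Read
variable {X Ω d n : Type*} [Fintype X] [Fintype Ω] [Fintype d] [Fintype n] {k : ℕ}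
  [DecidableEq X] [DecidableEq Ω] [DecidableEq d] [DecidableEq n]

lemma avg_K1 {μ : X → ℝ} (h1 : ∑ x, μ x = 1) (i : Fin k) (Φ : X → (Fin k → X) → ℝ) :
    ∑ s, μ s * ∑ x, wt μ x * ∑ x', wt μ x' *
      Φ s (Function.update (ov (fun j => j.val < i.val) x x') i s) = ∑ x, wt μ x * Φ (x i) x := by
  have h2 := fun x : Fin k → X => resample_upd2 h1 i
    (fun s z => Φ s (ov (fun j => j.val < i.val) x z))
  have h3 := resample h1 (fun j : Fin k => j.val < i.val) (fun z => Φ (z i) z)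
  simp only [smul_eq_mul] at h2 h3
  rw [← h3]
  simp only [← ov_upd_right]
  have h4 : ∑ s, μ s * ∑ x, wt μ x * ∑ x', wt μ x' *
      Φ s (ov (fun j => j.val < i.val) x (Function.update x' i s)) =
      ∑ x, wt μ x * ∑ s, ∑ x', (μ s * wt μ x') *
        Φ s (ov (fun j => j.val < i.val) x (Function.update x' i s)) := by
    simp only [Finset.mul_sum]
    rw [Finset.sum_comm]
    refine Finset.sum_congr rfl fun x _ => Finset.sum_congr rfl fun s _ =>
      Finset.sum_congr rfl fun x' _ => ?_
    ring
  rw [h4]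
  refine Finset.sum_congr rfl fun x _ => ?_
  rw [h2 x, Finset.mul_sum]
  refine Finset.sum_congr rfl fun x' _ => ?_
  have : ov (fun j : Fin k => j.val < i.val) x x' i = x' i := by simp [ov]
  rw [this, mul_assoc]

lemma stack_read {o J : Type*} [Fintype o] [Fintype J] {w : o → ℝ} (hw : ∀ x, 0 ≤ w x)
    (N : o → Matrix J d ℂ) (M : Matrix d n ℂ) (c : n) (g : J × o → ℝ) :
    ∑ r, g r * Complex.normSq ((stack w N * M) r c) =
      ∑ x, w x * ∑ j, g (j, x) * Complex.normSq ((N x * M) j c) := by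
  rw [stack_mul, Fintype.sum_prod_type, Finset.sum_comm]
  refine Finset.sum_congr rfl fun x _ => ?_
  rw [Finset.mul_sum]
  refine Finset.sum_congr rfl fun j _ => ?_
  rw [stack, normSq_sqrt_mul (hw _)]
  ring

lemma K1_read {μ : X → ℝ} (h0 : ∀ x, 0 ≤ μ x) (h1 : ∑ x, μ x = 1)
    (F : (Fin k → X) → Ω → Matrix d d ℂ) (i : Fin k) (M : Matrix d n ℂ) (c : n) (h : X → Ω → ℝ) :
    ∑ s, μ s * ∑ r, h s r.1.1.2 * Complex.normSq ((K1 μ F i s * M) r c) =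
      ∑ x, wt μ x * ∑ a, h (x i) a * ∑ l, Complex.normSq ((cfc Real.sqrt (F x a) * M) l c) := by
  rw [← avg_K1 h1 i (fun s x => ∑ a, h s a * ∑ l, Complex.normSq ((cfc Real.sqrt (F x a) * M) l c))]
  refine Finset.sum_congr rfl fun s _ => ?_
  congr 1
  refine (stack_read (wt_nonneg h0) _ M c
    (fun r : ((d × Ω) × (Fin k → X)) × (Fin k → X) => h s r.1.1.2)).trans ?_
  refine Finset.sum_congr rfl fun x _ => ?_
  congr 1
  refine (stack_read (wt_nonneg h0) _ M c (fun r : (d × Ω) × (Fin k → X) => h s r.1.2)).trans ?_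
  refine Finset.sum_congr rfl fun x' _ => ?_
  congr 1
  refine (stack_read (fun _ => zero_le_one) _ M c (fun r : d × Ω => h s r.2)).trans ?_
  refine Finset.sum_congr rfl fun a _ => ?_
  rw [one_mul, Finset.mul_sum]

lemma reorder1 {α β γ δ : Type*} [Fintype α] [Fintype β] [Fintype γ] [Fintype δ]
    (f : α → ℝ) (g : β → ℝ) (T : α → β → γ → δ → ℝ) :
    ∑ ξ, ∑ υ, (f ξ * g υ) * ∑ r, ∑ c, T ξ υ r c = ∑ υ, g υ * ∑ c, ∑ ξ, f ξ * ∑ r, T ξ υ r c := by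
  rw [Finset.sum_comm]
  refine Finset.sum_congr rfl fun υ _ => ?_
  rw [Finset.sum_comm (s := (Finset.univ : Finset δ)), Finset.mul_sum]
  refine Finset.sum_congr rfl fun ξ _ => ?_
  rw [← Finset.mul_sum, Finset.sum_comm (s := (Finset.univ : Finset δ))]
  ring

lemma reorder2 {α β γ δ ε : Type*} [Fintype α] [Fintype β] [Fintype γ] [Fintype δ] [Fintype ε]
    (p : α → ℝ) (g : β → ℝ) (h : α → γ → β → δ → ℝ) (T : α → γ → β → δ → ε → ℝ) :
    ∑ υ, g υ * ∑ c, ∑ x, p x * ∑ a, h x a υ c * ∑ l, T x a υ c l =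
      ∑ x, p x * ∑ a, ∑ l, ∑ υ, g υ * ∑ c, h x a υ c * T x a υ c l := by
  have e1 : ∑ υ, g υ * ∑ c, ∑ x, p x * ∑ a, h x a υ c * ∑ l, T x a υ c l =
      ∑ z : β × δ, ∑ w : α × γ × ε, g z.1 * (p w.1 * (h w.1 w.2.1 z.1 z.2 * T w.1 w.2.1 z.1 z.2 w.2.2)) := by
    simp only [Fintype.sum_prod_type, Finset.mul_sum]
  have e2 : ∑ x, p x * ∑ a, ∑ l, ∑ υ, g υ * ∑ c, h x a υ c * T x a υ c l =
      ∑ w : α × γ × ε, ∑ z : β × δ, g z.1 * (p w.1 * (h w.1 w.2.1 z.1 z.2 * T w.1 w.2.1 z.1 z.2 w.2.2)) := by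
    simp only [Fintype.sum_prod_type, Finset.mul_sum, mul_left_comm (p _)]
  rw [e1, e2, Finset.sum_comm]

lemma reorder3 {β δ ε : Type*} [Fintype β] [Fintype δ] [Fintype ε]
    (g : β → ℝ) (h : β → δ → ℝ) (T : β → δ → ε → ℝ) :
    ∑ l, ∑ y, g y * ∑ b, h y b * T y b l = ∑ y, g y * ∑ b, h y b * ∑ l, T y b l := by
  rw [Finset.sum_comm]
  refine Finset.sum_congr rfl fun y _ => ?_
  rw [← Finset.mul_sum, Finset.sum_comm]
  simp only [Finset.mul_sum]

end Read

section Core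
variable {X Y A B : Type} [Fintype X] [Fintype Y] [Fintype A] [Fintype B]
variable {m n : Type} [Fintype m] [Fintype n] {k : ℕ}

/-- Expected winning weight in a coordinate. -/
def wini (G : Game X Y A B) (μX : X → ℝ) (μY : Y → ℝ) (ψ : m × n → ℂ)
    (F : (Fin k → X) → (Fin k → A) → Matrix m m ℂ) (H : (Fin k → Y) → (Fin k → B) → Matrix n n ℂ)
    (i : Fin k) : ℝ :=
  ∑ x, wt μX x * ∑ a, ∑ y, wt μY y * ∑ b,
    (if G.V (x i) (y i) (a i) (b i) then 1 else 0) * br ψ (F x a) (H y b)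

variable [DecidableEq X] [DecidableEq Y] [DecidableEq A] [DecidableEq B] [DecidableEq m] [DecidableEq n]

lemma win_read (G : Game X Y A B) {μX : X → ℝ} {μY : Y → ℝ} (hX0 : ∀ x, 0 ≤ μX x)
    (hX1 : ∑ x, μX x = 1) (hY0 : ∀ y, 0 ≤ μY y) (hY1 : ∑ y, μY y = 1) (ψ : m × n → ℂ)
    {F : (Fin k → X) → (Fin k → A) → Matrix m m ℂ} {H : (Fin k → Y) → (Fin k → B) → Matrix n n ℂ}
    (hF : ∀ x a, (F x a).PosSemidef) (hH : ∀ y b, (H y b).PosSemidef) (i : Fin k) :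
    ∑ ξ, ∑ υ, (μX ξ * μY υ) * ∑ r, ∑ c, (if G.V ξ υ (r.1.1.2 i) (c.1.1.2 i) then 1 else 0) *
      Complex.normSq ((K1 μX F i ξ * vmat ψ * (K1 μY H i υ)ᵀ) r c) = wini G μX μY ψ F H i := by
  rw [reorder1 μX μY (fun ξ υ r c => (if G.V ξ υ (r.1.1.2 i) (c.1.1.2 i) then 1 else 0) *
      Complex.normSq ((K1 μX F i ξ * vmat ψ * (K1 μY H i υ)ᵀ) r c))]
  have e1 : ∀ (υ : Y) (c : (((n × (Fin k → B)) × (Fin k → Y)) × (Fin k → Y))),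
      ∑ ξ, μX ξ * ∑ r, (if G.V ξ υ (r.1.1.2 i) (c.1.1.2 i) then 1 else 0) *
        Complex.normSq ((K1 μX F i ξ * vmat ψ * (K1 μY H i υ)ᵀ) r c) =
      ∑ x, wt μX x * ∑ a, (if G.V (x i) υ (a i) (c.1.1.2 i) then 1 else 0) *
        ∑ l, Complex.normSq ((cfc Real.sqrt (F x a) * (vmat ψ * (K1 μY H i υ)ᵀ)) l c) := by
    intro υ c
    have := K1_read hX0 hX1 F i (vmat ψ * (K1 μY H i υ)ᵀ) c
      (fun ξ a => if G.V ξ υ (a i) (c.1.1.2 i) then 1 else 0)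
    simp only [← Matrix.mul_assoc] at this ⊢
    exact this
  refine (Finset.sum_congr rfl fun υ _ => congrArg (μY υ * ·)
    (Finset.sum_congr rfl fun c _ => e1 υ c)).trans ?_
  rw [reorder2 (wt μX) μY (fun x a υ c => if G.V (x i) υ (a i) (c.1.1.2 i) then 1 else 0)
    (fun x a υ c l => Complex.normSq ((cfc Real.sqrt (F x a) * (vmat ψ * (K1 μY H i υ)ᵀ)) l c)), wini]
  refine Finset.sum_congr rfl fun x _ => congrArg (wt μX x * ·) (Finset.sum_congr rfl fun a _ => ?_)
  have e2 : ∀ l, ∑ υ, μY υ * ∑ c, (if G.V (x i) υ (a i) (c.1.1.2 i) then 1 else 0) *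
      Complex.normSq ((cfc Real.sqrt (F x a) * (vmat ψ * (K1 μY H i υ)ᵀ)) l c) =
      ∑ y, wt μY y * ∑ b, (if G.V (x i) (y i) (a i) (b i) then 1 else 0) *
        ∑ l', Complex.normSq ((cfc Real.sqrt (H y b) * (cfc Real.sqrt (F x a) * vmat ψ)ᵀ) l' l) := by
    intro l
    have := K1_read hY0 hY1 H i ((cfc Real.sqrt (F x a) * vmat ψ)ᵀ) l
      (fun υ b => if G.V (x i) υ (a i) (b i) then 1 else 0)
    rw [← this]
    have e : ∀ υ, cfc Real.sqrt (F x a) * (vmat ψ * (K1 μY H i υ)ᵀ) =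
        (K1 μY H i υ * (cfc Real.sqrt (F x a) * vmat ψ)ᵀ)ᵀ := by
      intro υ
      rw [transpose_mul, transpose_transpose, Matrix.mul_assoc]
    simp only [e, transpose_apply]
  simp only [e2]
  rw [reorder3 (wt μY) (fun y b => if G.V (x i) (y i) (a i) (b i) then 1 else 0)
    (fun y b l => ∑ l', Complex.normSq ((cfc Real.sqrt (H y b) * (cfc Real.sqrt (F x a) * vmat ψ)ᵀ) l' l))]
  refine Finset.sum_congr rfl fun y _ => congrArg (wt μY y * ·) (Finset.sum_congr rfl fun b _ => ?_)
  congr 1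
  rw [Finset.sum_comm]
  have : br ψ (F x a) (H y b) = fsq (cfc Real.sqrt (H y b) * (cfc Real.sqrt (F x a) * vmat ψ)ᵀ) := by
    rw [← fsq_transpose, transpose_mul, transpose_transpose, ← br_fsq, cfc_sqrt_sq (hF x a),
      cfc_sqrt_sq (hH y b)]
  rw [this, fsq]

lemma young_le (a b : ℂ) {η : ℝ} (hη : 0 < η) :
    Complex.normSq a ≤ (1 + η) * Complex.normSq b + (1 + η⁻¹) * Complex.normSq (a - b) := by
  simp only [Complex.normSq_apply, Complex.sub_re, Complex.sub_im]
  have key : ∀ u v : ℝ, u * u ≤ (1 + η) * (v * v) + (1 + η⁻¹) * ((u - v) * (u - v)) := by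
    intro u v
    have h : (1 + η) * (v * v) + (1 + η⁻¹) * ((u - v) * (u - v)) - u * u =
        η⁻¹ * (η * v - (u - v)) ^ 2 := by
      field_simp
      ring
    have : 0 ≤ η⁻¹ * (η * v - (u - v)) ^ 2 := by positivity
    linarith
  have := key a.re b.re
  have := key a.im b.im
  linarith

lemma avg_le_one {Z Ω : Type*} [Fintype Z] [Fintype Ω] {μ : Z → ℝ} (h0 : ∀ x, 0 ≤ μ x)
    (h1 : ∑ x, μ x = 1) {F : (Fin k → Z) → Ω → Matrix m m ℂ}
    (hF1 : ∀ x, (1 - ∑ a, F x a).PosSemidef) :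
    (1 - ∑ x, wt μ x • ∑ a, F x a).PosSemidef := by
  have : 1 - ∑ x, wt μ x • ∑ a, F x a = ∑ x, wt μ x • (1 - ∑ a, F x a) := by
    simp only [smul_sub, Finset.sum_sub_distrib, ← Finset.sum_smul, wt_sum h1, one_smul]
  rw [this]
  exact psd_sum_smul (wt_nonneg h0) hF1

lemma avg_psd {Z Ω : Type*} [Fintype Z] [Fintype Ω] {μ : Z → ℝ} (h0 : ∀ x, 0 ≤ μ x)
    {F : (Fin k → Z) → Ω → Matrix m m ℂ} (hF : ∀ x a, (F x a).PosSemidef) :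
    (∑ x, wt μ x • ∑ a, F x a).PosSemidef :=
  psd_sum_smul (wt_nonneg h0) fun x => posSemidef_sum _ fun a _ => hF x a

end Core

section CoreLemma
variable {X Y A B : Type} [Fintype X] [Fintype Y] [Fintype A] [Fintype B]
variable {m n : Type} [Fintype m] [Fintype n] {k : ℕ}
variable [DecidableEq X] [DecidableEq Y] [DecidableEq A] [DecidableEq B] [DecidableEq m] [DecidableEq n]

lemma fsq_swap {p q : Type*} [Fintype p] [Fintype q] (P : Matrix p m ℂ) (Ψ : Matrix m n ℂ)
    (Q : Matrix q n ℂ) : fsq (Q * (Ψᵀ * Pᵀ)) = fsq (P * Ψ * Qᵀ) := by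
  rw [← fsq_transpose]
  congr 1
  simp only [transpose_mul, transpose_transpose]

/-- The distance bound for one pair of aligned contractions, before averaging. -/
lemma dist_bound {p q : Type*} [Fintype p] [Fintype q] [DecidableEq p] [DecidableEq q]
    (ψ : m × n → ℂ) (K K' : Matrix p m ℂ) (L L' : Matrix q n ℂ) (U : Matrix p p ℂ) (W : Matrix q q ℂ)
    (hW : Contr W) :
    fsq (K * vmat ψ * Lᵀ - U * (K' * vmat ψ * L'ᵀ) * Wᵀ) ≤
      2 * br ψ ((K - U * K')ᴴ * (K - U * K')) (L'ᴴ * L') +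
      2 * br ψ (Kᴴ * K) ((L - W * L')ᴴ * (L - W * L')) := by
  have e : K * vmat ψ * Lᵀ - U * (K' * vmat ψ * L'ᵀ) * Wᵀ =
      (K - U * K') * vmat ψ * (W * L')ᵀ + K * vmat ψ * (L - W * L')ᵀ := by
    simp only [transpose_sub, transpose_mul, Matrix.mul_sub, Matrix.sub_mul, Matrix.mul_assoc]
    abel
  rw [e]
  refine (fsq_add_le _ _).trans ?_
  rw [br_fsq, br_fsq]
  have : fsq ((K - U * K') * vmat ψ * (W * L')ᵀ) ≤ fsq ((K - U * K') * vmat ψ * L'ᵀ) := by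
    rw [← fsq_swap, ← fsq_swap, Matrix.mul_assoc]
    exact hW.fsq_le _
  linarith

lemma core [Nonempty A] [Nonempty B] (G : Game X Y A B) (hμ0 : ∀ p, 0 ≤ G.μ p)
    (hμ1 : ∑ p : X × Y, G.μ p = 1) {μX : X → ℝ} {μY : Y → ℝ} (hX0 : ∀ x, 0 ≤ μX x)
    (hX1 : ∑ x, μX x = 1) (hY0 : ∀ y, 0 ≤ μY y) (hY1 : ∑ y, μY y = 1)
    (hprod : ∀ x y, G.μ (x, y) = μX x * μY y) (ψ : m × n → ℂ) (hψ : fsq (vmat ψ) ≤ 1)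
    {F : (Fin k → X) → (Fin k → A) → Matrix m m ℂ} {H : (Fin k → Y) → (Fin k → B) → Matrix n n ℂ}
    (hF : ∀ x a, (F x a).PosSemidef) (hF1 : ∀ x, (1 - ∑ a, F x a).PosSemidef)
    (hH : ∀ y b, (H y b).PosSemidef) (hH1 : ∀ y, (1 - ∑ b, H y b).PosSemidef) :
    ∃ D : Fin k → ℝ, (∀ i, 0 ≤ D i) ∧
      ∑ i, D i ≤ 2 * Real.negMulLog (br ψ (∑ x, wt μX x • ∑ a, F x a) (∑ y, wt μY y • ∑ b, H y b)) ∧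
      ∀ i, ∀ η : ℝ, 0 < η → wini G μX μY ψ F H i ≤
        (1 + η) * (entangledValue G * br ψ (∑ x, wt μX x • ∑ a, F x a) (∑ y, wt μY y • ∑ b, H y b)) +
        (1 + η⁻¹) * (2 * D i) := by
  set Ab := ∑ x, wt μX x • ∑ a, F x a with hAb
  set Bb := ∑ y, wt μY y • ∑ b, H y b with hBb
  have hAbp : Ab.PosSemidef := avg_psd hX0 hF
  have hBbp : Bb.PosSemidef := avg_psd hY0 hH
  have hAb1 : (1 - Ab).PosSemidef := avg_le_one hX0 hX1 hF1
  have hBb1 : (1 - Bb).PosSemidef := avg_le_one hY0 hY1 hH1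
  set Ψ := vmat ψ with hΨ
  set M : Matrix m n ℂ := Ψ * (cfc Real.sqrt Bb)ᵀ with hM
  set M' : Matrix n m ℂ := Ψᵀ * (cfc Real.sqrt Ab)ᵀ with hM'
  have hM1 : fsq M ≤ 1 := by
    have h := br_fsq ψ (1 : Matrix m m ℂ) (cfc Real.sqrt Bb)
    rw [Matrix.one_mul, conjTranspose_one, Matrix.one_mul, cfc_sqrt_sq hBbp] at h
    have h2 := br_nonneg ψ (PosSemidef.one : (1 : Matrix m m ℂ).PosSemidef) hBb1
    have h3 := br_add_right ψ 1 Bb (1 - Bb)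
    rw [add_sub_cancel, br_one] at h3
    rw [hM, ← h]
    linarith
  have hM1' : fsq M' ≤ 1 := by
    have h := br_fsq ψ (cfc Real.sqrt Ab) (1 : Matrix n n ℂ)
    rw [conjTranspose_one, Matrix.one_mul, cfc_sqrt_sq hAbp, transpose_one, Matrix.mul_one] at h
    have h2 := br_nonneg ψ hAb1 (PosSemidef.one : (1 : Matrix n n ℂ).PosSemidef)
    have h3 := br_add_left ψ Ab (1 - Ab) 1
    rw [add_sub_cancel, br_one] at h3
    rw [hM', ← transpose_mul, fsq_transpose, ← h]
    linarith
  obtain ⟨U, hU, hUb⟩ := side hX0 hX1 hF hF1 M hM1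
  obtain ⟨W, hW, hWb⟩ := side hY0 hY1 hH hH1 M' hM1'
  have hq : (trace (Mᴴ * Ab * M)).re = br ψ Ab Bb := by
    rw [← cfc_sqrt_sq hAbp, ← fsq_mul, hM, ← Matrix.mul_assoc, ← br_fsq, cfc_sqrt_sq hAbp,
      cfc_sqrt_sq hBbp]
  have hq' : (trace (M'ᴴ * Bb * M')).re = br ψ Ab Bb := by
    rw [← cfc_sqrt_sq hBbp, ← fsq_mul, hM', fsq_swap, ← br_fsq, cfc_sqrt_sq hAbp,
      cfc_sqrt_sq hBbp]
  rw [← hAb, hq] at hUb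
  rw [← hBb, hq'] at hWb
  refine ⟨fun i => ∑ s, μX s * fsq ((K1 μX F i s - U i s * K0 μX F i) * M) +
    ∑ s, μY s * fsq ((K1 μY H i s - W i s * K0 μY H i) * M'), fun i => ?_, ?_, ?_⟩
  · exact add_nonneg (Finset.sum_nonneg fun s _ => mul_nonneg (hX0 s) (fsq_nonneg _))
      (Finset.sum_nonneg fun s _ => mul_nonneg (hY0 s) (fsq_nonneg _))
  · rw [Finset.sum_add_distrib]
    linarith
  · intro i η hη
    set DA := ∑ s, μX s * fsq ((K1 μX F i s - U i s * K0 μX F i) * M) with hDA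
    set DB := ∑ s, μY s * fsq ((K1 μY H i s - W i s * K0 μY H i) * M') with hDB
    set S := K0 μX F i * Ψ * (K0 μY H i)ᵀ with hS
    have hSq : fsq S = br ψ Ab Bb := by
      rw [hS, ← br_fsq, K0_gram hX0 hX1 hF, K0_gram hY0 hY1 hH]
    have hstrat := strat_le_val G hμ0 hμ1 S (fun r => r.1.1.2 i) (fun c => c.1.1.2 i) (U i) (W i)
      (hU i) (hW i)
    rw [hSq] at hstrat
    have hdA : ∀ s, br ψ ((K1 μX F i s - U i s * K0 μX F i)ᴴ * (K1 μX F i s - U i s * K0 μX F i)) Bb =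
        fsq ((K1 μX F i s - U i s * K0 μX F i) * M) := by
      intro s
      rw [hM, ← Matrix.mul_assoc, ← br_fsq, cfc_sqrt_sq hBbp]
    have hdB : ∀ s, br ψ Ab ((K1 μY H i s - W i s * K0 μY H i)ᴴ * (K1 μY H i s - W i s * K0 μY H i)) =
        fsq ((K1 μY H i s - W i s * K0 μY H i) * M') := by
      intro s
      rw [hM', fsq_swap, ← br_fsq, cfc_sqrt_sq hAbp]
    have hdist : ∑ ξ, ∑ υ, (μX ξ * μY υ) *
        fsq (K1 μX F i ξ * Ψ * (K1 μY H i υ)ᵀ - U i ξ * S * (W i υ)ᵀ) ≤ 2 * (DA + DB) := by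
      have h1 : ∑ ξ, ∑ υ, (μX ξ * μY υ) *
          fsq (K1 μX F i ξ * Ψ * (K1 μY H i υ)ᵀ - U i ξ * S * (W i υ)ᵀ) ≤
          ∑ ξ, ∑ υ, (μX ξ * μY υ) * (2 * fsq ((K1 μX F i ξ - U i ξ * K0 μX F i) * M) +
            2 * br ψ ((K1 μX F i ξ)ᴴ * K1 μX F i ξ)
              ((K1 μY H i υ - W i υ * K0 μY H i)ᴴ * (K1 μY H i υ - W i υ * K0 μY H i))) := by
        refine Finset.sum_le_sum fun ξ _ => Finset.sum_le_sum fun υ _ =>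
          mul_le_mul_of_nonneg_left ?_ (mul_nonneg (hX0 ξ) (hY0 υ))
        have := dist_bound ψ (K1 μX F i ξ) (K0 μX F i) (K1 μY H i υ) (K0 μY H i) (U i ξ) (W i υ) (hW i υ)
        rw [K0_gram hY0 hY1 hH, ← hBb, hdA] at this
        exact this
      refine h1.trans (le_of_eq ?_)
      simp only [mul_add, Finset.sum_add_distrib]
      congr 1
      · rw [hDA, Finset.mul_sum]
        refine Finset.sum_congr rfl fun ξ _ => ?_
        rw [← Finset.sum_mul, ← Finset.mul_sum, hY1]
        ring
      · rw [hDB, Finset.mul_sum, Finset.sum_comm]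
        refine Finset.sum_congr rfl fun υ _ => ?_
        rw [← hdB, hAb, ← K1_gram hX0 hX1 hF i, br_sum_left, Finset.mul_sum, Finset.mul_sum]
        refine Finset.sum_congr rfl fun ξ _ => ?_
        rw [br_smul_left]
        ring
    rw [← win_read G hX0 hX1 hY0 hY1 ψ hF hH i, ← hΨ]
    have hpt : ∀ ξ υ, ∑ r, ∑ c, (if G.V ξ υ (r.1.1.2 i) (c.1.1.2 i) then (1 : ℝ) else 0) *
        Complex.normSq ((K1 μX F i ξ * Ψ * (K1 μY H i υ)ᵀ) r c) ≤
        (1 + η) * (∑ r, ∑ c, (if G.V ξ υ (r.1.1.2 i) (c.1.1.2 i) then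
          Complex.normSq ((U i ξ * S * (W i υ)ᵀ) r c) else 0)) +
        (1 + η⁻¹) * fsq (K1 μX F i ξ * Ψ * (K1 μY H i υ)ᵀ - U i ξ * S * (W i υ)ᵀ) := by
      intro ξ υ
      simp only [fsq, Finset.mul_sum, ← Finset.sum_add_distrib]
      refine Finset.sum_le_sum fun r _ => Finset.sum_le_sum fun c _ => ?_
      rw [Matrix.sub_apply]
      have hy := young_le ((K1 μX F i ξ * Ψ * (K1 μY H i υ)ᵀ) r c) ((U i ξ * S * (W i υ)ᵀ) r c) hη
      have hn : 0 ≤ (1 + η⁻¹) * Complex.normSq ((K1 μX F i ξ * Ψ * (K1 μY H i υ)ᵀ) r c -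
          (U i ξ * S * (W i υ)ᵀ) r c) := mul_nonneg (by positivity) (Complex.normSq_nonneg _)
      split_ifs
      · rw [one_mul]; exact hy
      · rw [zero_mul, mul_zero, zero_add]; exact hn
    calc _ ≤ ∑ ξ, ∑ υ, (μX ξ * μY υ) * ((1 + η) * (∑ r, ∑ c, (if G.V ξ υ (r.1.1.2 i) (c.1.1.2 i) then
          Complex.normSq ((U i ξ * S * (W i υ)ᵀ) r c) else 0)) +
        (1 + η⁻¹) * fsq (K1 μX F i ξ * Ψ * (K1 μY H i υ)ᵀ - U i ξ * S * (W i υ)ᵀ)) :=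
          Finset.sum_le_sum fun ξ _ => Finset.sum_le_sum fun υ _ =>
            mul_le_mul_of_nonneg_left (hpt ξ υ) (mul_nonneg (hX0 ξ) (hY0 υ))
      _ = (1 + η) * (∑ ξ, ∑ υ, G.μ (ξ, υ) * ∑ r, ∑ c, (if G.V ξ υ (r.1.1.2 i) (c.1.1.2 i) then
          Complex.normSq ((U i ξ * S * (W i υ)ᵀ) r c) else 0)) +
          (1 + η⁻¹) * ∑ ξ, ∑ υ, (μX ξ * μY υ) *
            fsq (K1 μX F i ξ * Ψ * (K1 μY H i υ)ᵀ - U i ξ * S * (W i υ)ᵀ) := by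
          simp only [mul_add, Finset.sum_add_distrib, hprod]
          congr 1
          · rw [Finset.mul_sum]
            refine Finset.sum_congr rfl fun ξ _ => ?_
            rw [Finset.mul_sum]
            refine Finset.sum_congr rfl fun υ _ => ?_
            ring
          · rw [Finset.mul_sum]
            refine Finset.sum_congr rfl fun ξ _ => ?_
            rw [Finset.mul_sum]
            refine Finset.sum_congr rfl fun υ _ => ?_
            ring
      _ ≤ _ := by
          refine add_le_add (mul_le_mul_of_nonneg_left hstrat (by positivity))
            (mul_le_mul_of_nonneg_left hdist (by positivity))

end CoreLemma

section Assembly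
variable {X Y A B : Type} [Fintype X] [Fintype Y] [Fintype A] [Fintype B]
variable {m n : Type} [Fintype m] [Fintype n] {k : ℕ}
variable [DecidableEq X] [DecidableEq Y] [DecidableEq A] [DecidableEq B] [DecidableEq m] [DecidableEq n]

/-- Strategy with the questions in `C` fixed and the answers in `C` post-selected. -/
def fixS {Z Ω l : Type} [DecidableEq Ω] (C : Finset (Fin k))
    (F : (Fin k → Z) → (Fin k → Ω) → Matrix l l ℂ) (u : Fin k → Z) (α : C → Ω)
    (x : Fin k → Z) (a : Fin k → Ω) : Matrix l l ℂ :=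
  if (fun i : C => a i) = α then F (ov (fun i => i ∈ C) u x) a else 0

lemma fixS_psd {Z Ω l : Type} [Fintype l] [DecidableEq l] [DecidableEq Ω] (C : Finset (Fin k))
    {F : (Fin k → Z) → (Fin k → Ω) → Matrix l l ℂ} (hF : ∀ x a, (F x a).PosSemidef)
    (u : Fin k → Z) (α : C → Ω) (x : Fin k → Z) (a : Fin k → Ω) : (fixS C F u α x a).PosSemidef := by
  unfold fixS
  split_ifs
  · exact hF _ _
  · exact PosSemidef.zero

lemma fixS_le {Z Ω l : Type} [Fintype l] [DecidableEq l] [Fintype Ω] [DecidableEq Ω] (C : Finset (Fin k))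
    {F : (Fin k → Z) → (Fin k → Ω) → Matrix l l ℂ} (hF : ∀ x a, (F x a).PosSemidef)
    (hF1 : ∀ x, ∑ a, F x a = 1)
    (u : Fin k → Z) (α : C → Ω) (x : Fin k → Z) : (1 - ∑ a, fixS C F u α x a).PosSemidef := by
  rw [← hF1 (ov (fun i => i ∈ C) u x), ← Finset.sum_sub_distrib]
  refine posSemidef_sum _ fun a _ => ?_
  unfold fixS
  split_ifs
  · rw [sub_self]; exact PosSemidef.zero
  · rw [sub_zero]; exact hF _ _

lemma reorder4 {α β γ δ ε ζ : Type*} [Fintype α] [Fintype β] [Fintype γ] [Fintype δ] [Fintype ε]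
    [Fintype ζ] (i : α → β → ℝ) (p : γ → ℝ) (q : ε → ℝ) (T : α → β → γ → δ → ε → ζ → ℝ) :
    ∑ a, ∑ b, i a b * ∑ x, p x * ∑ c, ∑ y, q y * ∑ d, T a b x c y d =
      ∑ x, p x * ∑ c, ∑ y, q y * ∑ d, ∑ a, ∑ b, i a b * T a b x c y d := by
  have e1 : ∑ a, ∑ b, i a b * ∑ x, p x * ∑ c, ∑ y, q y * ∑ d, T a b x c y d =
      ∑ z : α × β, ∑ w : γ × δ × ε × ζ,
        i z.1 z.2 * (p w.1 * (q w.2.2.1 * T z.1 z.2 w.1 w.2.1 w.2.2.1 w.2.2.2)) := by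
    simp only [Fintype.sum_prod_type, Finset.mul_sum]
  have e2 : ∑ x, p x * ∑ c, ∑ y, q y * ∑ d, ∑ a, ∑ b, i a b * T a b x c y d =
      ∑ w : γ × δ × ε × ζ, ∑ z : α × β,
        i z.1 z.2 * (p w.1 * (q w.2.2.1 * T z.1 z.2 w.1 w.2.1 w.2.2.1 w.2.2.2)) := by
    simp only [Fintype.sum_prod_type, Finset.mul_sum]
    refine Finset.sum_congr rfl fun x _ => Finset.sum_congr rfl fun c _ => Finset.sum_congr rfl fun y _ =>
      Finset.sum_congr rfl fun d _ => Finset.sum_congr rfl fun a _ => Finset.sum_congr rfl fun b _ => ?_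
    ring
  rw [e1, e2, Finset.sum_comm]

lemma reorder5 {α β γ δ ε ζ : Type*} [Fintype α] [Fintype β] [Fintype γ] [Fintype δ] [Fintype ε]
    [Fintype ζ] (f : α → ℝ) (g : β → ℝ) (p : γ → ℝ) (q : ε → ℝ) (T : α → β → γ → δ → ε → ζ → ℝ) :
    ∑ u, ∑ v, (f u * g v) * ∑ x, p x * ∑ a, ∑ y, q y * ∑ b, T u v x a y b =
      ∑ u, ∑ x, (f u * p x) * ∑ v, ∑ y, (g v * q y) * ∑ a, ∑ b, T u v x a y b := by
  refine Finset.sum_congr rfl fun u _ => ?_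
  have e1 : ∑ v, (f u * g v) * ∑ x, p x * ∑ a, ∑ y, q y * ∑ b, T u v x a y b =
      ∑ v, ∑ x, ∑ y, ∑ a, ∑ b, (f u * g v) * (p x * (q y * T u v x a y b)) := by
    simp only [Finset.mul_sum]
    refine Finset.sum_congr rfl fun v _ => Finset.sum_congr rfl fun x _ => ?_
    rw [Finset.sum_comm]
  rw [e1, Finset.sum_comm]
  simp only [Finset.mul_sum]
  refine Finset.sum_congr rfl fun x _ => Finset.sum_congr rfl fun v _ => Finset.sum_congr rfl fun y _ =>
    Finset.sum_congr rfl fun a _ => Finset.sum_congr rfl fun b _ => ?_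
  ring

/-- Indicator that the fixed questions and answers win on `C`. -/
def indC (G : Game X Y A B) (C : Finset (Fin k)) (u : Fin k → X) (v : Fin k → Y) (α : C → A) (β : C → B) : ℝ :=
  if ∀ i : C, G.V (u i) (v i) (α i) (β i) = true then 1 else 0

lemma decomp (G : Game X Y A B) {μX : X → ℝ} {μY : Y → ℝ} (hX1 : ∑ x, μX x = 1)
    (hY1 : ∑ y, μY y = 1) (ψ : m × n → ℂ)
    (F : (Fin k → X) → (Fin k → A) → Matrix m m ℂ) (H : (Fin k → Y) → (Fin k → B) → Matrix n n ℂ)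
    (C : Finset (Fin k)) (g : (Fin k → X) → (Fin k → Y) → (Fin k → A) → (Fin k → B) → ℝ)
    (hg : ∀ u v x y a b, g (ov (fun i => i ∈ C) u x) (ov (fun i => i ∈ C) v y) a b = g x y a b) :
    ∑ u, ∑ v, (wt μX u * wt μY v) * ∑ α, ∑ β, indC G C u v α β *
      ∑ x, wt μX x * ∑ a, ∑ y, wt μY y * ∑ b, g x y a b * br ψ (fixS C F u α x a) (fixS C H v β y b) =
    ∑ x, wt μX x * ∑ y, wt μY y * ∑ a, ∑ b,
      (if ∀ i ∈ C, G.V (x i) (y i) (a i) (b i) = true then g x y a b * br ψ (F x a) (H y b) else 0) := by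
  set Φ : (Fin k → X) → (Fin k → Y) → ℝ := fun x y => ∑ a, ∑ b,
      (if ∀ i ∈ C, G.V (x i) (y i) (a i) (b i) = true then g x y a b * br ψ (F x a) (H y b) else 0) with hΦ
  have h1 : ∀ u v x y a b, (∑ α, ∑ β, indC G C u v α β *
      (g x y a b * br ψ (fixS C F u α x a) (fixS C H v β y b))) =
      (if ∀ i ∈ C, G.V (ov (fun i => i ∈ C) u x i) (ov (fun i => i ∈ C) v y i) (a i) (b i) = true then
        g (ov (fun i => i ∈ C) u x) (ov (fun i => i ∈ C) v y) a b *
        br ψ (F (ov (fun i => i ∈ C) u x) a) (H (ov (fun i => i ∈ C) v y) b) else 0) := by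
    intro u v x y a b
    rw [Finset.sum_eq_single (fun i : C => a i), Finset.sum_eq_single (fun i : C => b i)]
    · rw [hg, fixS, fixS, if_pos rfl, if_pos rfl, indC, ite_mul, one_mul, zero_mul]
      refine if_congr ?_ rfl rfl
      constructor
      · intro h i hi
        have := h ⟨i, hi⟩
        simpa [ov, hi] using this
      · rintro h ⟨i, hi⟩
        have := h i hi
        simpa [ov, hi] using this
    · intro β _ hβ
      have h0 : fixS C H v β y b = 0 := if_neg (fun h => hβ h.symm)
      rw [h0]
      simp [br]
    · simp
    · intro α _ hα
      refine Finset.sum_eq_zero fun β _ => ?_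
      rw [fixS, if_neg (fun h => hα h.symm)]
      simp [br]
    · simp
  have h2 : ∀ u v, (∑ α, ∑ β, indC G C u v α β *
      ∑ x, wt μX x * ∑ a, ∑ y, wt μY y * ∑ b, g x y a b * br ψ (fixS C F u α x a) (fixS C H v β y b)) =
      ∑ x, wt μX x * ∑ a, ∑ y, wt μY y * ∑ b,
      (if ∀ i ∈ C, G.V (ov (fun i => i ∈ C) u x i) (ov (fun i => i ∈ C) v y i) (a i) (b i) = true then
        g (ov (fun i => i ∈ C) u x) (ov (fun i => i ∈ C) v y) a b *
        br ψ (F (ov (fun i => i ∈ C) u x) a) (H (ov (fun i => i ∈ C) v y) b) else 0) := by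
    intro u v
    rw [reorder4 (indC G C u v) (wt μX) (wt μY)
      (fun α β x a y b => g x y a b * br ψ (fixS C F u α x a) (fixS C H v β y b))]
    simp only [h1]
  simp only [h2]
  rw [reorder5 (wt μX) (wt μY) (wt μX) (wt μY) (fun u v x a y b =>
    (if ∀ i ∈ C, G.V (ov (fun i => i ∈ C) u x i) (ov (fun i => i ∈ C) v y i) (a i) (b i) = true then
        g (ov (fun i => i ∈ C) u x) (ov (fun i => i ∈ C) v y) a b *
        br ψ (F (ov (fun i => i ∈ C) u x) a) (H (ov (fun i => i ∈ C) v y) b) else 0))]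
  have r1 := fun x => resample hY1 (fun i : Fin k => i ∈ C) (fun y => Φ x y)
  have r2 := resample hX1 (fun i : Fin k => i ∈ C) (fun x => ∑ y, wt μY y * Φ x y)
  simp only [smul_eq_mul] at r1 r2
  rw [← r2]
  simp only [← r1]
  rfl

lemma tangent {t c : ℝ} (ht : 0 ≤ t) (hc : 0 < c) :
    Real.negMulLog t ≤ -t * Real.log c + c - t := by
  rcases ht.eq_or_lt with rfl | ht
  · simp [hc.le]
  · have h := Real.log_le_sub_one_of_pos (div_pos hc ht)
    rw [Real.log_div hc.ne' ht.ne'] at h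
    have h2 := mul_le_mul_of_nonneg_left h ht.le
    have h3 : t * (c / t - 1) = c - t := by field_simp
    rw [h3] at h2
    rw [Real.negMulLog]
    linarith

end Assembly

section Final

lemma avg_good {Z : Type*} [Fintype Z] {k : ℕ} {w : Z → ℝ} (hw : ∀ z, 0 ≤ w z) {N : ℝ} (hN : 0 < N)
    (hwN : ∑ z, w z ≤ N) {q : Z → ℝ} (hq : ∀ z, 0 ≤ q z) {D win : Z → Fin k → ℝ}
    (hD0 : ∀ z i, 0 ≤ D z i) (hD : ∀ z, ∑ i, D z i ≤ 2 * Real.negMulLog (q z)) {ω η : ℝ} (hη : 0 < η)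
    (hwin : ∀ z i, win z i ≤ (1 + η) * (ω * q z) + (1 + η⁻¹) * (2 * D z i)) {Q : ℝ}
    (hQ : Q = ∑ z, w z * q z) (hQ0 : 0 < Q) (I : Finset (Fin k)) :
    ∑ i ∈ I, ∑ z, w z * win z i ≤
      I.card * ((1 + η) * (ω * Q)) + (1 + η⁻¹) * (4 * (Q * Real.log (N / Q))) := by
  have hent : ∑ z, w z * Real.negMulLog (q z) ≤ Q * Real.log (N / Q) := by
    have hc : 0 < Q / N := div_pos hQ0 hN
    calc ∑ z, w z * Real.negMulLog (q z) ≤ ∑ z, w z * (-q z * Real.log (Q / N) + Q / N - q z) :=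
          Finset.sum_le_sum fun z _ => mul_le_mul_of_nonneg_left (tangent (hq z) hc) (hw z)
      _ = ∑ z, ((w z * q z) * (-Real.log (Q / N) - 1) + w z * (Q / N)) :=
          Finset.sum_congr rfl fun z _ => by ring
      _ = Q * (-Real.log (Q / N) - 1) + (∑ z, w z) * (Q / N) := by
          rw [Finset.sum_add_distrib, ← Finset.sum_mul, ← Finset.sum_mul, ← hQ]
      _ ≤ Q * (-Real.log (Q / N) - 1) + N * (Q / N) := by
          have := mul_le_mul_of_nonneg_right hwN hc.le
          linarith
      _ = Q * Real.log (N / Q) := by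
          rw [mul_div_cancel₀ _ hN.ne', Real.log_div hQ0.ne' hN.ne', Real.log_div hN.ne' hQ0.ne']
          ring
  have hη1 : 0 ≤ 1 + η⁻¹ := by positivity
  calc ∑ i ∈ I, ∑ z, w z * win z i
      ≤ ∑ i ∈ I, ∑ z, w z * ((1 + η) * (ω * q z) + (1 + η⁻¹) * (2 * D z i)) :=
        Finset.sum_le_sum fun i _ => Finset.sum_le_sum fun z _ =>
          mul_le_mul_of_nonneg_left (hwin z i) (hw z)
    _ = ∑ i ∈ I, ((1 + η) * (ω * Q) + (1 + η⁻¹) * (2 * ∑ z, w z * D z i)) := by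
        refine Finset.sum_congr rfl fun i _ => ?_
        simp only [hQ, Finset.mul_sum, ← Finset.sum_add_distrib]
        refine Finset.sum_congr rfl fun z _ => ?_
        ring
    _ = I.card * ((1 + η) * (ω * Q)) + (1 + η⁻¹) * (2 * ∑ z, w z * ∑ i ∈ I, D z i) := by
        rw [Finset.sum_add_distrib, Finset.sum_const, nsmul_eq_mul, ← Finset.mul_sum, ← Finset.mul_sum,
          Finset.sum_comm]
        simp only [Finset.mul_sum]
    _ ≤ I.card * ((1 + η) * (ω * Q)) + (1 + η⁻¹) * (2 * ∑ z, w z * (2 * Real.negMulLog (q z))) := by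
        have : ∑ z, w z * ∑ i ∈ I, D z i ≤ ∑ z, w z * (2 * Real.negMulLog (q z)) :=
          Finset.sum_le_sum fun z _ => mul_le_mul_of_nonneg_left
            ((Finset.sum_le_sum_of_subset_of_nonneg (Finset.subset_univ I)
              (fun i _ _ => hD0 z i)).trans (hD z)) (hw z)
        have h2 := mul_le_mul_of_nonneg_left this hη1
        linarith
    _ ≤ _ := by
        have : ∑ z, w z * (2 * Real.negMulLog (q z)) = 2 * ∑ z, w z * Real.negMulLog (q z) := by
          rw [Finset.mul_sum]
          exact Finset.sum_congr rfl fun z _ => by ring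
        rw [this]
        have h2 := mul_le_mul_of_nonneg_left hent hη1
        linarith

variable {X Y A B : Type} [Fintype X] [Fintype Y] [Fintype A] [Fintype B]
  [DecidableEq X] [DecidableEq Y] [DecidableEq A] [DecidableEq B]

/-- Probability of winning all coordinates in `C`. -/
def PrC (G : Game X Y A B) {k : ℕ} (P : (Fin k → X) → (Fin k → Y) → (Fin k → A) → (Fin k → B) → ℝ)
    (C : Finset (Fin k)) : ℝ :=
  ∑ x, ∑ y, ∑ a, ∑ b, if ∀ i ∈ C, G.V (x i) (y i) (a i) (b i) = true then P x y a b else 0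

lemma br_expand {m n : Type} [Fintype m] [Fintype n] {k : ℕ} (μX : X → ℝ) (μY : Y → ℝ) (ψ : m × n → ℂ)
    (F : (Fin k → X) → (Fin k → A) → Matrix m m ℂ) (H : (Fin k → Y) → (Fin k → B) → Matrix n n ℂ) :
    ∑ x, wt μX x * ∑ a, ∑ y, wt μY y * ∑ b, (1 : ℝ) * br ψ (F x a) (H y b) =
      br ψ (∑ x, wt μX x • ∑ a, F x a) (∑ y, wt μY y • ∑ b, H y b) := by
  rw [br_sum_left]
  refine Finset.sum_congr rfl fun x _ => ?_
  rw [br_smul_left, br_sum_left]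
  congr 1
  refine Finset.sum_congr rfl fun a _ => ?_
  rw [br_sum_right]
  refine Finset.sum_congr rfl fun y _ => ?_
  rw [br_smul_right, br_sum_right]
  simp only [one_mul]

lemma good [Nonempty A] [Nonempty B] (G : Game X Y A B) (hμ0 : ∀ p, 0 ≤ G.μ p)
    (hμ1 : ∑ p : X × Y, G.μ p = 1) {μX : X → ℝ} {μY : Y → ℝ} (hX0 : ∀ x, 0 ≤ μX x)
    (hX1 : ∑ x, μX x = 1) (hY0 : ∀ y, 0 ≤ μY y) (hY1 : ∑ y, μY y = 1)
    (hprod : ∀ x y, G.μ (x, y) = μX x * μY y) {k : ℕ}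
    {dA dB : ℕ} (ψ : Fin dA × Fin dB → ℂ) (hψ : star ψ ⬝ᵥ ψ = 1)
    (Al : (Fin k → X) → (Fin k → A) → Matrix (Fin dA) (Fin dA) ℂ)
    (Bo : (Fin k → Y) → (Fin k → B) → Matrix (Fin dB) (Fin dB) ℂ)
    (hAlpsd : ∀ x a, (Al x a).PosSemidef) (hAlsum : ∀ x, ∑ a, Al x a = 1)
    (hBopsd : ∀ y b, (Bo y b).PosSemidef) (hBosum : ∀ y, ∑ b, Bo y b = 1)
    (P : (Fin k → X) → (Fin k → Y) → (Fin k → A) → (Fin k → B) → ℝ)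
    (hP : ∀ x y a b, P x y a b =
      (∏ i, G.μ (x i, y i)) * (star ψ ⬝ᵥ ((Al x a ⊗ₖ Bo y b) *ᵥ ψ)).re)
    (C I : Finset (Fin k)) (hI : ∀ i ∈ I, i ∉ C) (hQ0 : 0 < PrC G P C) {η : ℝ} (hη : 0 < η) :
    ∑ i ∈ I, PrC G P (insert i C) ≤ I.card * ((1 + η) * (entangledValue G * PrC G P C)) +
      (1 + η⁻¹) * (4 * (PrC G P C *
        Real.log (((Fintype.card A : ℝ) * Fintype.card B) ^ C.card / PrC G P C))) := by
  have hψ1 : fsq (vmat ψ) ≤ 1 := by rw [← star_dot_self, hψ, Complex.one_re]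
  have hPr : ∀ C' : Finset (Fin k), PrC G P C' = ∑ x, wt μX x * ∑ y, wt μY y * ∑ a, ∑ b,
      (if ∀ i ∈ C', G.V (x i) (y i) (a i) (b i) = true then br ψ (Al x a) (Bo y b) else 0) := by
    intro C'
    simp only [PrC, Finset.mul_sum]
    refine Finset.sum_congr rfl fun x _ => Finset.sum_congr rfl fun y _ => Finset.sum_congr rfl fun a _ =>
      Finset.sum_congr rfl fun b _ => ?_
    rw [hP]
    simp only [hprod, Finset.prod_mul_distrib]
    split_ifs
    · rw [br, wt, wt, mul_assoc]
    · simp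
  set w : ((Fin k → X) × (Fin k → Y)) × ((C → A) × (C → B)) → ℝ := fun z =>
    (wt μX z.1.1 * wt μY z.1.2) * indC G C z.1.1 z.1.2 z.2.1 z.2.2 with hw
  have hind : ∀ u v α β, 0 ≤ indC G C u v α β ∧ indC G C u v α β ≤ 1 := by
    intro u v α β
    unfold indC
    split_ifs <;> norm_num
  have hw0 : ∀ z, 0 ≤ w z := fun z =>
    mul_nonneg (mul_nonneg (wt_nonneg hX0 _) (wt_nonneg hY0 _)) (hind _ _ _ _).1
  have hwN : ∑ z, w z ≤ ((Fintype.card A : ℝ) * Fintype.card B) ^ C.card := by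
    calc ∑ z, w z ≤ ∑ z : ((Fin k → X) × (Fin k → Y)) × ((C → A) × (C → B)), wt μX z.1.1 * wt μY z.1.2 :=
          Finset.sum_le_sum fun z _ => mul_le_of_le_one_right
            (mul_nonneg (wt_nonneg hX0 _) (wt_nonneg hY0 _)) (hind _ _ _ _).2
      _ = _ := by
          rw [Fintype.sum_prod_type]
          simp only [Finset.sum_const, nsmul_eq_mul, ← Finset.mul_sum]
          rw [Fintype.sum_prod_type]
          simp only [← Finset.mul_sum, wt_sum hY1, mul_one, wt_sum hX1]
          simp [mul_pow]
  have hconv : ∀ f : (Fin k → X) → (Fin k → Y) → (C → A) → (C → B) → ℝ,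
      ∑ u, ∑ v, (wt μX u * wt μY v) * ∑ α, ∑ β, indC G C u v α β * f u v α β =
        ∑ z, w z * f z.1.1 z.1.2 z.2.1 z.2.2 := by
    intro f
    simp only [hw, Fintype.sum_prod_type, Finset.mul_sum, mul_assoc]
  have hcore := fun z : ((Fin k → X) × (Fin k → Y)) × ((C → A) × (C → B)) =>
    core G hμ0 hμ1 hX0 hX1 hY0 hY1 hprod ψ hψ1
      (fixS_psd C hAlpsd z.1.1 z.2.1) (fixS_le C hAlpsd hAlsum z.1.1 z.2.1)
      (fixS_psd C hBopsd z.1.2 z.2.2) (fixS_le C hBopsd hBosum z.1.2 z.2.2)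
  choose D hD0 hD hwin using hcore
  have hQ : PrC G P C = ∑ z, w z * br ψ (∑ x, wt μX x • ∑ a, fixS C Al z.1.1 z.2.1 x a)
      (∑ y, wt μY y • ∑ b, fixS C Bo z.1.2 z.2.2 y b) := by
    rw [hPr, ← hconv (fun u v α β => br ψ (∑ x, wt μX x • ∑ a, fixS C Al u α x a)
      (∑ y, wt μY y • ∑ b, fixS C Bo v β y b))]
    have := decomp G hX1 hY1 ψ Al Bo C (fun _ _ _ _ => 1) (fun _ _ _ _ _ _ => rfl)
    simp only [br_expand] at this
    rw [this]
    simp only [one_mul]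
  have hwi : ∀ i ∈ I, PrC G P (insert i C) = ∑ z, w z * wini G μX μY ψ (fixS C Al z.1.1 z.2.1)
      (fixS C Bo z.1.2 z.2.2) i := by
    intro i hi
    have hiC := hI i hi
    rw [hPr, ← hconv (fun u v α β => wini G μX μY ψ (fixS C Al u α) (fixS C Bo v β) i)]
    have := decomp G hX1 hY1 ψ Al Bo C (fun x y a b => if G.V (x i) (y i) (a i) (b i) then 1 else 0)
      (fun u v x y a b => by simp [ov, hiC])
    refine Eq.trans ?_ this.symm
    refine Finset.sum_congr rfl fun x _ => congrArg (wt μX x * ·) (Finset.sum_congr rfl fun y _ =>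
      congrArg (wt μY y * ·) (Finset.sum_congr rfl fun a _ => Finset.sum_congr rfl fun b _ => ?_))
    simp only [Finset.forall_mem_insert]
    by_cases h1 : G.V (x i) (y i) (a i) (b i) = true <;>
      by_cases h2 : ∀ j ∈ C, G.V (x j) (y j) (a j) (b j) = true <;> simp [h1]
  rw [Finset.sum_congr rfl hwi]
  refine avg_good hw0 (by positivity) hwN (fun z => ?_) hD0 hD hη (fun z i => hwin z i η hη) hQ hQ0 I
  exact br_nonneg ψ (avg_psd hX0 (fixS_psd C hAlpsd _ _)) (avg_psd hY0 (fixS_psd C hBopsd _ _))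

end Final


section Greedy

/-- The numerical heart of the choice of a good coordinate. -/
lemma num_bound {n k ω t Q L s : ℝ} (hn : 0.9 * k ≤ n) (hk : 0 < k) (hω : ω ≤ 1) (ht : 0 < t)
    (ht2 : t ≤ 0.32) (hQ : 0 < Q) (hL : L ≤ 0.7 * k * t ^ 2) (hs : t ≤ s) :
    n * ((1 + t) * (ω * Q)) + (1 + t⁻¹) * (4 * (Q * L)) ≤ n * ((ω + 12 * s) * Q) := by
  have hn0 : 0 < n := by linarith
  have h1 : (1 + t⁻¹) * L ≤ 0.7 * k * (t + t ^ 2) := by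
    calc (1 + t⁻¹) * L ≤ (1 + t⁻¹) * (0.7 * k * t ^ 2) := by gcongr
      _ = 0.7 * k * (t + t ^ 2) := by field_simp; ring
  have h2 : k * (t + t ^ 2) ≤ k * (1.32 * t) := by
    gcongr
    nlinarith
  have h3 : k * t ≤ n / 0.9 * t := by
    gcongr
    rw [le_div_iff₀ (by norm_num)]
    linarith
  have h4 : n * t * ω ≤ n * t * 1 := by gcongr
  have h5 : n * t ≤ n * s := by gcongr
  have h6 : 0 < n * t := by positivity
  have key : n * ((1 + t) * ω) + (1 + t⁻¹) * (4 * L) ≤ n * (ω + 12 * s) := by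
    nlinarith
  calc _ = (n * ((1 + t) * ω) + (1 + t⁻¹) * (4 * L)) * Q := by ring
    _ ≤ n * (ω + 12 * s) * Q := by gcongr
    _ = _ := by ring

/-- Greedy selection of coordinates. -/
def greedy {α : Type} [DecidableEq α] (g : Finset α → α) : ℕ → Finset α
  | 0 => ∅
  | n + 1 => insert (g (greedy g n)) (greedy g n)

lemma greedy_card {α : Type} [DecidableEq α] (g : Finset α → α) (n : ℕ) :
    (greedy g n).card ≤ n := by
  induction n with
  | zero => simp [greedy]
  | succ n ih => exact (Finset.card_insert_le _ _).trans (by omega)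

lemma greedy_mem {α : Type} [DecidableEq α] (g : Finset α → α) (n : ℕ) (i : α) :
    i ∈ greedy g n ↔ ∃ j < n, i = g (greedy g j) := by
  induction n with
  | zero => simp [greedy]
  | succ n ih =>
    rw [greedy, Finset.mem_insert, ih]
    constructor
    · rintro (h | ⟨j, hj, h⟩)
      · exact ⟨n, by omega, h⟩
      · exact ⟨j, by omega, h⟩
    · rintro ⟨j, hj, h⟩
      rcases Nat.lt_succ_iff_lt_or_eq.mp hj with h' | rfl
      · exact Or.inr ⟨j, h', h⟩
      · exact Or.inl h

lemma succProb_eq {X Y A B : Type} [Fintype X] [Fintype Y] [Fintype A] [Fintype B]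
    [DecidableEq X] [DecidableEq Y] [DecidableEq A] [DecidableEq B] (G : Game X Y A B) {k : ℕ}
    (P : (Fin k → X) → (Fin k → Y) → (Fin k → A) → (Fin k → B) → ℝ) {k' : ℕ}
    (g : Finset (Fin k) → Fin k) {r : ℕ} (hr : r ≤ k') :
    succProb G P (fun j : Fin k' => g (greedy g j)) r = PrC G P (greedy g r) := by
  unfold succProb PrC
  refine Finset.sum_congr rfl fun x _ => Finset.sum_congr rfl fun y _ =>
    Finset.sum_congr rfl fun a _ => Finset.sum_congr rfl fun b _ => if_congr ?_ rfl rfl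
  constructor
  · intro h i hi
    obtain ⟨j, hj, rfl⟩ := (greedy_mem g r i).mp hi
    exact h ⟨j, by omega⟩ hj
  · intro h j hj
    exact h _ ((greedy_mem g r _).mpr ⟨j, hj, rfl⟩)

lemma exists_good {X Y A B : Type} [Fintype X] [Fintype Y] [Fintype A] [Fintype B]
    [DecidableEq X] [DecidableEq Y] [DecidableEq A] [DecidableEq B]
    [Nonempty A] [Nonempty B] (G : Game X Y A B) (hμ0 : ∀ p, 0 ≤ G.μ p)
    (hμ1 : ∑ p : X × Y, G.μ p = 1) {μX : X → ℝ} {μY : Y → ℝ} (hX0 : ∀ x, 0 ≤ μX x)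
    (hX1 : ∑ x, μX x = 1) (hY0 : ∀ y, 0 ≤ μY y) (hY1 : ∑ y, μY y = 1)
    (hprod : ∀ x y, G.μ (x, y) = μX x * μY y) {k : ℕ} (hk : 1 ≤ k)
    {dA dB : ℕ} (ψ : Fin dA × Fin dB → ℂ) (hψ : star ψ ⬝ᵥ ψ = 1)
    (Al : (Fin k → X) → (Fin k → A) → Matrix (Fin dA) (Fin dA) ℂ)
    (Bo : (Fin k → Y) → (Fin k → B) → Matrix (Fin dB) (Fin dB) ℂ)
    (hAlpsd : ∀ x a, (Al x a).PosSemidef) (hAlsum : ∀ x, ∑ a, Al x a = 1)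
    (hBopsd : ∀ y b, (Bo y b).PosSemidef) (hBosum : ∀ y, ∑ b, Bo y b = 1)
    (P : (Fin k → X) → (Fin k → Y) → (Fin k → A) → (Fin k → B) → ℝ)
    (hP : ∀ x y a b, P x y a b =
      (∏ i, G.μ (x i, y i)) * (star ψ ⬝ᵥ ((Al x a ⊗ₖ Bo y b) *ᵥ ψ)).re)
    (δ₁ δ₂ δ₃ : ℝ) (hδ₁' : δ₁ < 0.1) (hδ₃ : 0 < δ₃) (hδ₃' : δ₃ < 0.1)
    (hδ : δ₃ = δ₂ + δ₁ * Real.logb 2 ((Fintype.card A : ℝ) * Fintype.card B))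
    (C : Finset (Fin k)) (hC : (C.card : ℝ) ≤ δ₁ * k) :
    ∃ i, i ∉ C ∧ (PrC G P C ≤ (2 : ℝ) ^ (-(δ₂ * (k : ℝ))) ∨
        PrC G P (insert i C) / PrC G P C ≤ entangledValue G + 12 * Real.sqrt (10 * δ₃)) := by
  have hk0 : (0 : ℝ) < k := by exact_mod_cast hk
  have hcard : (Cᶜ.card : ℝ) = k - C.card := by
    rw [Finset.card_compl, Fintype.card_fin, Nat.cast_sub]
    simpa using Finset.card_le_univ C
  have hn : 0.9 * (k : ℝ) ≤ (Cᶜ.card : ℝ) := by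
    rw [hcard]
    nlinarith
  have hne : (Cᶜ).Nonempty := by
    rw [← Finset.card_pos]
    have : (0 : ℝ) < (Cᶜ.card : ℝ) := by linarith
    exact_mod_cast this
  by_cases hQ : PrC G P C ≤ (2 : ℝ) ^ (-(δ₂ * (k : ℝ)))
  · obtain ⟨i, hi⟩ := hne
    exact ⟨i, Finset.mem_compl.mp hi, Or.inl hQ⟩
  rw [not_le] at hQ
  have hQ0 : 0 < PrC G P C := lt_trans (by positivity) hQ
  by_contra hcon
  push Not at hcon
  have ht : 0 < Real.sqrt δ₃ := Real.sqrt_pos.mpr hδ₃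
  have hgood := good G hμ0 hμ1 hX0 hX1 hY0 hY1 hprod ψ hψ Al Bo hAlpsd hAlsum hBopsd hBosum P hP
    C Cᶜ (fun i hi => Finset.mem_compl.mp hi) hQ0 ht
  have hlow : ∑ i ∈ Cᶜ, ((entangledValue G + 12 * Real.sqrt (10 * δ₃)) * PrC G P C) <
      ∑ i ∈ Cᶜ, PrC G P (insert i C) := by
    refine Finset.sum_lt_sum_of_nonempty hne fun i hi => ?_
    have := (hcon i (Finset.mem_compl.mp hi)).2
    rwa [lt_div_iff₀ hQ0] at this
  rw [Finset.sum_const, nsmul_eq_mul] at hlow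
  have hN : (1 : ℝ) ≤ (Fintype.card A : ℝ) * Fintype.card B := by
    have h1 : 1 ≤ Fintype.card A * Fintype.card B := Nat.mul_pos Fintype.card_pos Fintype.card_pos
    exact_mod_cast h1
  set N : ℝ := (Fintype.card A : ℝ) * Fintype.card B with hNdef
  have hlogQ : -(δ₂ * k) * Real.log 2 ≤ Real.log (PrC G P C) := by
    have := Real.log_le_log (by positivity) hQ.le
    rwa [Real.log_rpow (by norm_num)] at this
  have hl2 : 0 < Real.log 2 := Real.log_pos (by norm_num)
  have hl2' : Real.log 2 < 0.7 := by linarith [Real.log_two_lt_d9]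
  have hL : Real.log (N ^ C.card / PrC G P C) ≤ 0.7 * k * (Real.sqrt δ₃) ^ 2 := by
    rw [Real.log_div (by positivity) hQ0.ne', Real.log_pow, Real.sq_sqrt hδ₃.le]
    have h1 : (C.card : ℝ) * Real.log N ≤ δ₁ * k * Real.log N :=
      mul_le_mul_of_nonneg_right hC (Real.log_nonneg hN)
    have h2 : δ₁ * k * Real.log N + δ₂ * k * Real.log 2 = Real.log 2 * (k * δ₃) := by
      rw [hδ, Real.logb]
      field_simp
      ring
    have h3 : Real.log 2 * (k * δ₃) ≤ 0.7 * (k * δ₃) := by gcongr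
    linarith
  have ht2 : Real.sqrt δ₃ ≤ 0.32 := by
    rw [Real.sqrt_le_left (by norm_num)]
    norm_num at hδ₃' ⊢
    linarith
  have hs : Real.sqrt δ₃ ≤ Real.sqrt (10 * δ₃) := Real.sqrt_le_sqrt (by linarith)
  have := num_bound hn hk0 (val_le_one G hμ0 hμ1) ht ht2 hQ0 hL hs
  linarith

end Greedy

/-- **Main Lemma.** Fix an entangled strategy for `G^k`, where the
question distribution of `G` is a product distribution. Let
`0 < δ₁, δ₂, δ₃ < 0.1` with `δ₃ = δ₂ + δ₁·log₂(|A|·|B|)` and `k' = ⌊δ₁·k⌋`. Then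
there are distinct coordinates `i₁, …, i_{k'}` such that for every `1 ≤ r ≤ k'−1`,
either `Pr[T^{(r)} = 1] ≤ 2^{−δ₂·k}`, or
`Pr[T_{i_{r+1}} = 1 ∣ T^{(r)} = 1] ≤ ω*(G) + 12·√(10·δ₃)`. -/
theorem main_lemma_coordinates
    {X Y A B : Type} [Fintype X] [Fintype Y] [Fintype A] [Fintype B]
    [Nonempty X] [Nonempty Y] [Nonempty A] [Nonempty B]
    (G : Game X Y A B)
    (hμ0 : ∀ p, 0 ≤ G.μ p) (hμ1 : ∑ p : X × Y, G.μ p = 1)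
    (μX : X → ℝ) (μY : Y → ℝ)
    (hμX0 : ∀ x, 0 ≤ μX x) (hμX1 : ∑ x : X, μX x = 1)
    (hμY0 : ∀ y, 0 ≤ μY y) (hμY1 : ∑ y : Y, μY y = 1)
    (hprod : ∀ x y, G.μ (x, y) = μX x * μY y)
    (k : ℕ) (hk : 1 ≤ k)
    -- the fixed entangled strategy for G^k
    (dA dB : ℕ) (ψ : Fin dA × Fin dB → ℂ) (hψ : star ψ ⬝ᵥ ψ = 1)
    (Al : (Fin k → X) → (Fin k → A) → Matrix (Fin dA) (Fin dA) ℂ)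
    (Bo : (Fin k → Y) → (Fin k → B) → Matrix (Fin dB) (Fin dB) ℂ)
    (hAlpsd : ∀ x a, (Al x a).PosSemidef) (hAlsum : ∀ x, ∑ a, Al x a = 1)
    (hBopsd : ∀ y b, (Bo y b).PosSemidef) (hBosum : ∀ y, ∑ b, Bo y b = 1)
    -- the induced joint distribution of questions and answers
    (P : (Fin k → X) → (Fin k → Y) → (Fin k → A) → (Fin k → B) → ℝ)
    (hP : ∀ x y a b, P x y a b =
      (∏ i, G.μ (x i, y i)) * (star ψ ⬝ᵥ ((Al x a ⊗ₖ Bo y b) *ᵥ ψ)).re)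
    (δ₁ δ₂ δ₃ : ℝ)
    (hδ₁ : 0 < δ₁) (hδ₁' : δ₁ < 0.1)
    (hδ₂ : 0 < δ₂) (hδ₂' : δ₂ < 0.1)
    (hδ₃ : 0 < δ₃) (hδ₃' : δ₃ < 0.1)
    (hδ : δ₃ = δ₂ + δ₁ * Real.logb 2 ((Fintype.card A : ℝ) * Fintype.card B))
    (k' : ℕ) (hk' : k' = ⌊δ₁ * (k : ℝ)⌋₊) :
    ∃ idx : Fin k' → Fin k, Function.Injective idx ∧
      ∀ r : ℕ, 1 ≤ r → r ≤ k' - 1 →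
        succProb G P idx r ≤ (2 : ℝ) ^ (-(δ₂ * (k : ℝ))) ∨
        succProb G P idx (r + 1) / succProb G P idx r ≤
          entangledValue G + 12 * Real.sqrt (10 * δ₃) := by
  classical
  have hk0 : (0 : ℝ) ≤ k := Nat.cast_nonneg k
  have hex : ∀ C : Finset (Fin k), ∃ i, (C.card : ℝ) ≤ δ₁ * k →
      i ∉ C ∧ (PrC G P C ≤ (2 : ℝ) ^ (-(δ₂ * (k : ℝ))) ∨
        PrC G P (insert i C) / PrC G P C ≤ entangledValue G + 12 * Real.sqrt (10 * δ₃)) := by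
    intro C
    by_cases hC : (C.card : ℝ) ≤ δ₁ * k
    · obtain ⟨i, hi⟩ := exists_good G hμ0 hμ1 hμX0 hμX1 hμY0 hμY1 hprod hk ψ hψ Al Bo hAlpsd hAlsum
        hBopsd hBosum P hP δ₁ δ₂ δ₃ hδ₁' hδ₃ hδ₃' hδ C hC
      exact ⟨i, fun _ => hi⟩
    · exact ⟨⟨0, hk⟩, fun h => absurd h hC⟩
  choose g hg using hex
  have hk'' : (k' : ℝ) ≤ δ₁ * k := by
    rw [hk']
    exact Nat.floor_le (by positivity)
  have hcard : ∀ n, n ≤ k' → ((greedy g n).card : ℝ) ≤ δ₁ * k := by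
    intro n hn
    have h1 : ((greedy g n).card : ℝ) ≤ (k' : ℝ) := by exact_mod_cast (greedy_card g n).trans hn
    linarith
  have hlt : ∀ i j : Fin k', (i : ℕ) < j → g (greedy g i) ≠ g (greedy g j) := by
    intro i j hij h
    refine (hg (greedy g j) (hcard j j.2.le)).1 ?_
    rw [greedy_mem]
    exact ⟨i, hij, h.symm⟩
  refine ⟨fun j => g (greedy g j), ?_, ?_⟩
  · intro i j h
    rcases lt_trichotomy (i : ℕ) j with h1 | h1 | h1
    · exact absurd h (hlt i j h1)
    · exact Fin.ext h1
    · exact absurd h.symm (hlt j i h1)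
  · intro r hr1 hr2
    rw [succProb_eq G P g (show r ≤ k' by omega), succProb_eq G P g (show r + 1 ≤ k' by omega)]
    exact (hg (greedy g r) (hcard r (by omega))).2
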